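/- arXiv:math/0309020 — 7 statements merged into one kernel-verified Lean document; each statement's English description precedes it below -/
import Mathlib

section
/- Let H be a separable infinite-dimensional real Hilbert space with an orthogonal splitting H = H⁻ ⊕ H⁺ into two infinite-dimensional closed subspaces, with orthogonal projections P⁻ and P⁺. Then for every natural number k there exists a C^∞ path A : ℝ → L(H) such that each A(t) is self-adjoint and invertible, A(t) = P⁺ − P⁻ for every t ∉ (0,1), and, denoting by X : ℝ → L(H) the solution of the linear Cauchy problem X′(t) = A(t)X(t), X(0) = I (each X(t) is invertible), the subspaces W^s = {ξ ∈ H : X(t)ξ → 0 as t → +∞} and W^u = {ξ ∈ H : X(t)ξ → 0 as t → −∞} satisfy W^s + W^u = H and dim(W^s ∩ W^u) = k. -/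
open Module Submodule Filter

section Defs

variable {H : Type*} [NormedAddCommGroup H] [InnerProductSpace ℝ H] [CompleteSpace H]

/-- The orthogonal projection onto a closed subspace of a real Hilbert space,
as a continuous linear operator `H →L[ℝ] H`. -/
noncomputable def orthProjL (V : Submodule ℝ H) (hV : IsClosed (V : Set H)) : H →L[ℝ] H :=
  haveI : CompleteSpace V := hV.completeSpace_coe
  V.subtypeL.comp (orthogonalProjection V)

/-- The linear stable space of a path `X` of operators:
`W^s = {ξ : X(t)ξ → 0 as t → +∞}`. -/
def stableSpace (X : ℝ → (H →L[ℝ] H)) : Submodule ℝ H where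
  carrier := {ξ | Tendsto (fun t => X t ξ) atTop (nhds 0)}
  add_mem' := by
    intro a b ha hb
    have := ha.add hb
    simpa using this
  zero_mem' := by simp [tendsto_const_nhds]
  smul_mem' := by
    intro c x hx
    have := hx.const_smul c
    simpa using this

/-- The linear unstable space of a path `X` of operators:
`W^u = {ξ : X(t)ξ → 0 as t → -∞}`. -/
def unstableSpace (X : ℝ → (H →L[ℝ] H)) : Submodule ℝ H where
  carrier := {ξ | Tendsto (fun t => X t ξ) atBot (nhds 0)}
  add_mem' := by
    intro a b ha hb
    have := ha.add hb
    simpa using this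
  zero_mem' := by simp [tendsto_const_nhds]
  smul_mem' := by
    intro c x hx
    have := hx.const_smul c
    simpa using this

end Defs

theorem aux_basis (K : Type*) [NormedAddCommGroup K] [InnerProductSpace ℝ K] [CompleteSpace K]
    [TopologicalSpace.SeparableSpace K] (h : ¬ FiniteDimensional ℝ K) :
    Nonempty (HilbertBasis ℕ ℝ K) := by
  obtain ⟨w, b, hb⟩ := exists_hilbertBasis ℝ K
  have hbo := b.orthonormal
  have hc : Countable w := by
    refine Pairwise.countable_of_isOpen_disjoint (s := fun i : w => Metric.ball (b i) (1/2))
      ?_ (fun i => Metric.isOpen_ball) (fun i => ⟨b i, Metric.mem_ball_self (by norm_num)⟩)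
    intro i j hij
    refine Metric.ball_disjoint_ball ?_
    have h0 : inner ℝ (b i) (b j) = 0 := hbo.2 hij
    have h1 := norm_sub_sq_real (b i) (b j)
    rw [h0, hbo.1 i, hbo.1 j] at h1
    rw [dist_eq_norm]
    nlinarith [norm_nonneg (b i - b j)]
  have hi : Infinite w := by
    by_contra hfin
    rw [not_infinite_iff_finite] at hfin
    have := Fintype.ofFinite w
    exact h (Module.Finite.of_basis b.toOrthonormalBasis.toBasis)
  obtain ⟨e⟩ : Nonempty (ℕ ≃ w) := by
    have := nonempty_equiv_of_countable (α := ℕ) (β := w)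
    exact this
  refine ⟨HilbertBasis.mk (hbo.comp e e.injective) ?_⟩
  rw [Set.range_comp, e.range_eq_univ, Set.image_univ]
  exact b.dense_span.ge

theorem aux_isom (K K' : Type*) [NormedAddCommGroup K] [InnerProductSpace ℝ K] [CompleteSpace K]
    [TopologicalSpace.SeparableSpace K] (h : ¬ FiniteDimensional ℝ K)
    [NormedAddCommGroup K'] [InnerProductSpace ℝ K'] [CompleteSpace K']
    [TopologicalSpace.SeparableSpace K'] (h' : ¬ FiniteDimensional ℝ K') :
    Nonempty (K ≃ₗᵢ[ℝ] K') := by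
  obtain ⟨b⟩ := aux_basis K h
  obtain ⟨b'⟩ := aux_basis K' h'
  exact ⟨b.repr.trans b'.repr.symm⟩

theorem aux_finsub {H : Type*} [NormedAddCommGroup H] [InnerProductSpace ℝ H] [CompleteSpace H]
    [TopologicalSpace.SeparableSpace H] (V : Submodule ℝ H) (hV : IsClosed (V : Set H))
    (h : ¬ FiniteDimensional ℝ V) (k : ℕ) :
    ∃ E : Submodule ℝ H, E ≤ V ∧ FiniteDimensional ℝ E ∧ finrank ℝ E = k := by
  have : CompleteSpace V := hV.completeSpace_coe
  obtain ⟨b⟩ := aux_basis V h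
  have hl : LinearIndependent ℝ (fun i : Fin k => ((b i : V) : H)) := by
    have h1 := b.orthonormal.linearIndependent.comp (fun i : Fin k => (i : ℕ)) Fin.val_injective
    exact h1.map' V.subtype V.ker_subtype
  refine ⟨span ℝ (Set.range (fun i : Fin k => ((b i : V) : H))), ?_, ?_, ?_⟩
  · rw [span_le]; rintro _ ⟨i, rfl⟩; exact (b i).2
  · exact FiniteDimensional.span_of_finite ℝ (Set.finite_range _)
  · rw [finrank_span_eq_card hl, Fintype.card_fin]

/-- partial isometry between orthogonal closed subspaces -/
theorem aux_pair {H : Type*} [NormedAddCommGroup H] [InnerProductSpace ℝ H] [CompleteSpace H]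
    [TopologicalSpace.SeparableSpace H] (V G : Submodule ℝ H)
    [CompleteSpace V] [CompleteSpace G]
    (h : ¬ FiniteDimensional ℝ V) (h' : ¬ FiniteDimensional ℝ G) :
    ∃ J J' : H →L[ℝ] H, IsSelfAdjoint (J + J') ∧
      (∀ x, J x ∈ G) ∧ (∀ x, J' x ∈ V) ∧ (∀ x ∈ Vᗮ, J x = 0) ∧ (∀ x ∈ Gᗮ, J' x = 0) ∧
      (∀ x ∈ V, J' (J x) = x) ∧ (∀ x ∈ G, J (J' x) = x) := by
  obtain ⟨e⟩ := aux_isom V G h h'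
  refine ⟨G.subtypeL ∘L (e : V →L[ℝ] G) ∘L V.orthogonalProjectionOnto,
    V.subtypeL ∘L (e.symm : G →L[ℝ] V) ∘L G.orthogonalProjectionOnto, ?_, ?_, ?_, ?_, ?_, ?_, ?_⟩
  · rw [ContinuousLinearMap.isSelfAdjoint_iff_isSymmetric]
    intro x y
    have h1 : ∀ x y : H, inner ℝ (e (V.orthogonalProjectionOnto x) : H) y
        = inner ℝ x (e.symm (G.orthogonalProjectionOnto y) : H) := by
      intro x y
      rw [← Submodule.inner_orthogonalProjectionOnto_eq_of_mem_left,
        ← Submodule.inner_orthogonalProjectionOnto_eq_of_mem_right, ← e.inner_map_map, e.apply_symm_apply]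
    have h2 := h1 x y
    have h3 := h1 y x
    rw [real_inner_comm, real_inner_comm _ y] at h3
    simp [inner_add_left, inner_add_right, h2, h3]
    ring
  · intro x; simp
  · intro x; simp
  · intro x hx; simpa using hx
  · intro x hx; simpa using hx
  · intro x hx
    lift x to V using hx
    simp
  · intro x hx
    lift x to G using hx
    simp

theorem aux_cutoffs (a : ℝ) : ∃ c d : ℝ → ℝ, ContDiff ℝ (⊤ : ℕ∞) c ∧ ContDiff ℝ (⊤ : ℕ∞) d ∧
    (∀ t, t < a + 1/4 → c t = 1 ∧ deriv c t = 0) ∧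
    (∀ t, a + 3/8 < t → c t = 0 ∧ deriv c t = 0) ∧
    (∀ t, t < a + 1/16 → d t = 0 ∧ deriv d t = 0) ∧
    (∀ t, a + 1/8 < t → d t = 1 ∧ deriv d t = 0) := by
  have key : ∀ (f : ℝ → ℝ) (s : Set ℝ) (v : ℝ), IsOpen s → (∀ t ∈ s, f t = v) →
      ∀ t ∈ s, f t = v ∧ deriv f t = 0 := by
    intro f s v hs hf t ht
    refine ⟨hf t ht, ?_⟩
    have : f =ᶠ[nhds t] fun _ => v := by
      filter_upwards [hs.mem_nhds ht] with x hx using hf x hx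
    rw [this.deriv_eq]; simp
  refine ⟨fun t => 1 - Real.smoothTransition (16 * (t - a) - 4),
    fun t => Real.smoothTransition (16 * (t - a) - 1), ?_, ?_, ?_, ?_, ?_, ?_⟩
  · have := Real.smoothTransition.contDiff (n := (⊤ : ℕ∞))
    fun_prop
  · have := Real.smoothTransition.contDiff (n := (⊤ : ℕ∞))
    fun_prop
  · refine key _ (Set.Iio (a + 1/4)) 1 isOpen_Iio ?_
    intro t ht
    rw [Set.mem_Iio] at ht
    simp only [Real.smoothTransition.zero_of_nonpos (show 16 * (t - a) - 4 ≤ 0 by linarith), sub_zero]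
  · refine key _ (Set.Ioi (a + 3/8)) 0 isOpen_Ioi ?_
    intro t ht
    rw [Set.mem_Ioi] at ht
    simp only [Real.smoothTransition.one_of_one_le (show 1 ≤ 16 * (t - a) - 4 by linarith), sub_self]
  · refine key _ (Set.Iio (a + 1/16)) 0 isOpen_Iio ?_
    intro t ht
    rw [Set.mem_Iio] at ht
    simp only [Real.smoothTransition.zero_of_nonpos (show 16 * (t - a) - 1 ≤ 0 by linarith)]
  · refine key _ (Set.Ioi (a + 1/8)) 1 isOpen_Ioi ?_
    intro t ht
    rw [Set.mem_Ioi] at ht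
    simp only [Real.smoothTransition.one_of_one_le (show 1 ≤ 16 * (t - a) - 1 by linarith)]

theorem aux_scal (p q p' q' : ℝ → ℝ) (hp : ∀ t, HasDerivAt p (p' t) t)
    (hq : ∀ t, HasDerivAt q (q' t) t)
    (sp : ContDiff ℝ (⊤ : ℕ∞) p) (sq : ContDiff ℝ (⊤ : ℕ∞) q)
    (h0 : ∀ t, p t ^ 2 + q t ^ 2 ≠ 0) (h1 : ∀ t, p' t ≠ 0 ∨ q' t ≠ 0) :
    ∃ α β : ℝ → ℝ, ContDiff ℝ (⊤ : ℕ∞) α ∧ ContDiff ℝ (⊤ : ℕ∞) β ∧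
      (∀ t, α t ^ 2 + β t ^ 2 ≠ 0) ∧
      (∀ t, HasDerivAt p (α t * p t + β t * q t) t) ∧
      (∀ t, HasDerivAt q (β t * p t - α t * q t) t) ∧
      (∀ t, q t = 0 → q' t = 0 → p' t = p t → α t = 1 ∧ β t = 0) ∧
      (∀ t, p t = 0 → p' t = 0 → q' t = - q t → α t = 1 ∧ β t = 0) := by
  have sp' : ContDiff ℝ (⊤ : ℕ∞) p' := by
    have : p' = deriv p := funext fun t => (hp t).deriv.symm
    rw [this]; exact (contDiff_infty_iff_deriv.1 sp).2
  have sq' : ContDiff ℝ (⊤ : ℕ∞) q' := by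
    have : q' = deriv q := funext fun t => (hq t).deriv.symm
    rw [this]; exact (contDiff_infty_iff_deriv.1 sq).2
  refine ⟨fun t => (p' t * p t - q' t * q t) / (p t ^ 2 + q t ^ 2),
    fun t => (p' t * q t + q' t * p t) / (p t ^ 2 + q t ^ 2), ?_, ?_, ?_, ?_, ?_, ?_, ?_⟩
  · exact ContDiff.div (by fun_prop) (by fun_prop) h0
  · exact ContDiff.div (by fun_prop) (by fun_prop) h0
  · intro t
    have e : ((p' t * p t - q' t * q t) / (p t ^ 2 + q t ^ 2)) ^ 2 +
        ((p' t * q t + q' t * p t) / (p t ^ 2 + q t ^ 2)) ^ 2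
        = (p' t ^ 2 + q' t ^ 2) / (p t ^ 2 + q t ^ 2) := by
      have := h0 t
      field_simp
      ring
    show ((p' t * p t - q' t * q t) / (p t ^ 2 + q t ^ 2)) ^ 2 +
        ((p' t * q t + q' t * p t) / (p t ^ 2 + q t ^ 2)) ^ 2 ≠ 0
    rw [e]
    refine div_ne_zero ?_ (h0 t)
    rcases h1 t with h | h <;> positivity
  · intro t
    convert hp t using 1
    have := h0 t
    field_simp
    ring
  · intro t
    convert hq t using 1
    have := h0 t
    field_simp
    ring
  · intro t h2 h3 h4
    have := h0 t
    simp only [h2, h3, h4]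
    rw [h2] at this
    constructor
    · rw [div_eq_one_iff_eq this]; ring
    · simp
  · intro t h2 h3 h4
    have := h0 t
    simp only [h2, h3, h4]
    rw [h2] at this
    constructor
    · rw [div_eq_one_iff_eq this]; ring
    · simp

theorem aux_step1 (a : ℝ) : ∃ α β p q : ℝ → ℝ,
    ContDiff ℝ (⊤ : ℕ∞) α ∧ ContDiff ℝ (⊤ : ℕ∞) β ∧
      (∀ t, α t ^ 2 + β t ^ 2 ≠ 0) ∧
      (∀ t ∉ Set.Ioo a (a + 1/2), α t = 1 ∧ β t = 0) ∧
      (∀ t, HasDerivAt p (α t * p t + β t * q t) t) ∧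
      (∀ t, HasDerivAt q (β t * p t - α t * q t) t) ∧
      p a = Real.exp a ∧ q a = 0 ∧ p (a + 1/2) = 0 ∧ q (a + 1/2) = Real.exp (-(a + 1/2)) := by
  obtain ⟨c, d, sc, sd, c1, c0, d0, d1⟩ := aux_cutoffs a
  have hc : ∀ t, HasDerivAt c (deriv c t) t := fun t =>
    ((sc.differentiable (by simp)) t).hasDerivAt
  have hd : ∀ t, HasDerivAt d (deriv d t) t := fun t =>
    ((sd.differentiable (by simp)) t).hasDerivAt
  have hcd : ∀ t, (c t = 1 ∧ deriv c t = 0) ∨ (d t = 1 ∧ deriv d t = 0) := by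
    intro t
    rcases lt_or_ge t (a + 1/4) with h | h
    · exact Or.inl (c1 t h)
    · exact Or.inr (d1 t (by linarith))
  obtain ⟨α, β, sα, sβ, hne, h1, h2, h3, h4⟩ := aux_scal (fun t => Real.exp t * c t)
    (fun t => Real.exp (-t) * d t)
    (fun t => Real.exp t * (c t + deriv c t)) (fun t => Real.exp (-t) * (deriv d t - d t))
    (fun t => ((Real.hasDerivAt_exp t).mul (hc t)).congr_deriv (by ring))
    (fun t => (((hasDerivAt_neg t).exp).mul (hd t)).congr_deriv (by ring))
    (by have := Real.contDiff_exp (n := (⊤ : ℕ∞)); fun_prop)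
    (by have := Real.contDiff_exp (n := (⊤ : ℕ∞)); fun_prop)
    (by
      intro t
      rcases hcd t with ⟨h, -⟩ | ⟨h, -⟩ <;> simp only [h] <;> positivity)
    (by
      intro t
      rcases hcd t with ⟨h, h'⟩ | ⟨h, h'⟩ <;> simp [h, h', Real.exp_ne_zero])
  refine ⟨α, β, _, _, sα, sβ, hne, ?_, h1, h2, ?_, ?_, ?_, ?_⟩
  · intro t ht
    rcases le_or_gt t a with h | h
    · obtain ⟨e1, e2⟩ := c1 t (by linarith)
      obtain ⟨e3, e4⟩ := d0 t (by linarith)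
      apply h3 <;> simp [e1, e2, e3, e4]
    · have h' : a + 1/2 ≤ t := by
        by_contra hh
        exact ht ⟨h, not_le.1 hh⟩
      obtain ⟨e1, e2⟩ := c0 t (by linarith)
      obtain ⟨e3, e4⟩ := d1 t (by linarith)
      apply h4 <;> simp [e1, e2, e3, e4]
  · simp [(c1 a (by linarith)).1]
  · simp [(d0 a (by linarith)).1]
  · show _ * c (a + 1/2) = 0
    rw [(c0 (a + 1/2) (by linarith)).1, mul_zero]
  · show _ * d (a + 1/2) = _
    rw [(d1 (a + 1/2) (by linarith)).1, mul_one]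

theorem aux_step2 (a : ℝ) : ∃ α β p q : ℝ → ℝ,
    ContDiff ℝ (⊤ : ℕ∞) α ∧ ContDiff ℝ (⊤ : ℕ∞) β ∧
      (∀ t, α t ^ 2 + β t ^ 2 ≠ 0) ∧
      (∀ t ∉ Set.Ioo a (a + 1/2), α t = 1 ∧ β t = 0) ∧
      (∀ t, HasDerivAt p (α t * p t + β t * q t) t) ∧
      (∀ t, HasDerivAt q (β t * p t - α t * q t) t) ∧
      p a = 0 ∧ q a = Real.exp (-a) ∧ p (a + 1/2) = Real.exp (a + 1/2) ∧ q (a + 1/2) = 0 := by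
  obtain ⟨c, d, sc, sd, c1, c0, d0, d1⟩ := aux_cutoffs a
  have hc : ∀ t, HasDerivAt c (deriv c t) t := fun t =>
    ((sc.differentiable (by simp)) t).hasDerivAt
  have hd : ∀ t, HasDerivAt d (deriv d t) t := fun t =>
    ((sd.differentiable (by simp)) t).hasDerivAt
  have hcd : ∀ t, (c t = 1 ∧ deriv c t = 0) ∨ (d t = 1 ∧ deriv d t = 0) := by
    intro t
    rcases lt_or_ge t (a + 1/4) with h | h
    · exact Or.inl (c1 t h)
    · exact Or.inr (d1 t (by linarith))
  obtain ⟨α, β, sα, sβ, hne, h1, h2, h3, h4⟩ := aux_scal (fun t => Real.exp t * d t)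
    (fun t => Real.exp (-t) * c t)
    (fun t => Real.exp t * (d t + deriv d t)) (fun t => Real.exp (-t) * (deriv c t - c t))
    (fun t => ((Real.hasDerivAt_exp t).mul (hd t)).congr_deriv (by ring))
    (fun t => (((hasDerivAt_neg t).exp).mul (hc t)).congr_deriv (by ring))
    (by have := Real.contDiff_exp (n := (⊤ : ℕ∞)); fun_prop)
    (by have := Real.contDiff_exp (n := (⊤ : ℕ∞)); fun_prop)
    (by
      intro t
      rcases hcd t with ⟨h, -⟩ | ⟨h, -⟩ <;> simp only [h] <;> positivity)
    (by
      intro t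
      rcases hcd t with ⟨h, h'⟩ | ⟨h, h'⟩ <;> simp [h, h', Real.exp_ne_zero])
  refine ⟨α, β, _, _, sα, sβ, hne, ?_, h1, h2, ?_, ?_, ?_, ?_⟩
  · intro t ht
    rcases le_or_gt t a with h | h
    · obtain ⟨e1, e2⟩ := c1 t (by linarith)
      obtain ⟨e3, e4⟩ := d0 t (by linarith)
      apply h4 <;> simp [e1, e2, e3, e4]
    · have h' : a + 1/2 ≤ t := by
        by_contra hh
        exact ht ⟨h, not_le.1 hh⟩
      obtain ⟨e1, e2⟩ := c0 t (by linarith)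
      obtain ⟨e3, e4⟩ := d1 t (by linarith)
      apply h3 <;> simp [e1, e2, e3, e4]
  · simp [(d0 a (by linarith)).1]
  · simp [(c1 a (by linarith)).1]
  · show _ * d (a + 1/2) = _
    rw [(d1 (a + 1/2) (by linarith)).1, mul_one]
  · show _ * c (a + 1/2) = 0
    rw [(c0 (a + 1/2) (by linarith)).1, mul_zero]

theorem aux_unique {H : Type*} [NormedAddCommGroup H] [NormedSpace ℝ H]
    (A : ℝ → (H →L[ℝ] H)) (hA : Continuous A) (u v : ℝ → H) (a b : ℝ)
    (hu : ∀ t ∈ Set.Icc a b, HasDerivAt u (A t (u t)) t)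
    (hv : ∀ t ∈ Set.Icc a b, HasDerivAt v (A t (v t)) t)
    (h : u a = v a ∨ u b = v b) : Set.EqOn u v (Set.Icc a b) := by
  obtain ⟨C, hC⟩ := (isCompact_Icc (a := a) (b := b)).exists_bound_of_continuousOn hA.continuousOn
  have hL : ∀ t ∈ Set.Icc a b, LipschitzOnWith (Real.toNNReal C) (fun x => A t x) Set.univ := by
    intro t ht
    refine LipschitzWith.lipschitzOnWith ((A t).lipschitz.weaken ?_)
    rw [← NNReal.coe_le_coe]
    exact (hC t ht).trans (Real.le_coe_toNNReal C)
  have cu : ContinuousOn u (Set.Icc a b) := fun t ht => (hu t ht).continuousAt.continuousWithinAt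
  have cv : ContinuousOn v (Set.Icc a b) := fun t ht => (hv t ht).continuousAt.continuousWithinAt
  rcases h with h | h
  · exact ODE_solution_unique_of_mem_Icc_right (v := fun t x => A t x) (s := fun _ => Set.univ)
      (fun t ht => hL t (Set.Ico_subset_Icc_self ht)) cu
      (fun t ht => (hu t (Set.Ico_subset_Icc_self ht)).hasDerivWithinAt) (fun _ _ => trivial) cv
      (fun t ht => (hv t (Set.Ico_subset_Icc_self ht)).hasDerivWithinAt) (fun _ _ => trivial) h
  · exact ODE_solution_unique_of_mem_Icc_left (v := fun t x => A t x) (s := fun _ => Set.univ)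
      (fun t ht => hL t (Set.Ioc_subset_Icc_self ht)) cu
      (fun t ht => (hu t (Set.Ioc_subset_Icc_self ht)).hasDerivWithinAt) (fun _ _ => trivial) cv
      (fun t ht => (hv t (Set.Ioc_subset_Icc_self ht)).hasDerivWithinAt) (fun _ _ => trivial) h

theorem aux_unit {R : Type*} [Ring R] [Algebra ℝ R] (S T N : R) (α β : ℝ)
    (h : α ^ 2 + β ^ 2 ≠ 0)
    (hSS : S * S = 1 - N) (hTT : T * T = 1 - N) (hST : S * T + T * S = 0)
    (hNS : N * S = 0) (hSN : S * N = 0) (hNT : N * T = 0) (hTN : T * N = 0) (hNN : N * N = N) :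
    IsUnit (α • S + β • T - N) := by
  have e : (α • S + β • T) * (α • S + β • T) = (α ^ 2 + β ^ 2) • (1 - N) := by
    have : (α • S + β • T) * (α • S + β • T) =
        (α ^ 2) • (S * S) + (α * β) • (S * T + T * S) + (β ^ 2) • (T * T) := by
      simp only [add_mul, mul_add, smul_mul_assoc, mul_smul_comm, smul_smul, smul_add, pow_two,
        mul_comm β α]
      abel
    rw [this, hSS, hTT, hST, smul_zero, add_zero, ← add_smul]
  have e1 : N * (α • S + β • T) = 0 := by simp [mul_add, hNS, hNT]
  have e2 : (α • S + β • T) * N = 0 := by simp [add_mul, hSN, hTN]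
  rw [isUnit_iff_exists]
  refine ⟨(α ^ 2 + β ^ 2)⁻¹ • (α • S + β • T) - N, ?_, ?_⟩
  · rw [sub_mul, mul_sub, mul_sub, mul_smul_comm, mul_smul_comm, e, e1, e2, hNN,
      inv_smul_smul₀ h]
    simp
  · rw [sub_mul, mul_sub, mul_sub, smul_mul_assoc, smul_mul_assoc, e, e1, e2, hNN,
      inv_smul_smul₀ h]
    simp

structure AuxPIso {H : Type*} [NormedAddCommGroup H] [InnerProductSpace ℝ H]
    (P Q J J' : H →L[ℝ] H) : Prop where
  PP : ∀ x, P (P x) = P x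
  QQ : ∀ x, Q (Q x) = Q x
  PQ : ∀ x, P (Q x) = 0
  QP : ∀ x, Q (P x) = 0
  PJ : ∀ x, P (J x) = 0
  QJ : ∀ x, Q (J x) = J x
  PJ' : ∀ x, P (J' x) = J' x
  QJ' : ∀ x, Q (J' x) = 0
  JJ : ∀ x, J (J x) = 0
  J'J' : ∀ x, J' (J' x) = 0
  JP : ∀ x, J (P x) = J x
  J'Q : ∀ x, J' (Q x) = J' x
  JQ : ∀ x, J (Q x) = 0
  J'P : ∀ x, J' (P x) = 0
  JJ' : ∀ x, J (J' x) = Q x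
  J'J : ∀ x, J' (J x) = P x

theorem aux_piso {H : Type*} [NormedAddCommGroup H] [InnerProductSpace ℝ H] [CompleteSpace H]
    [TopologicalSpace.SeparableSpace H] (V G : Submodule ℝ H)
    [CompleteSpace V] [CompleteSpace G] (hVG : G ≤ Vᗮ)
    (h : ¬ FiniteDimensional ℝ V) (h' : ¬ FiniteDimensional ℝ G) :
    ∃ J J' : H →L[ℝ] H, IsSelfAdjoint (J + J') ∧
      AuxPIso V.starProjection G.starProjection J J' := by
  obtain ⟨J, J', hs, hJ, hJ', hJ0, hJ'0, h1, h2⟩ := aux_pair V G h h'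
  have hGV : V ≤ Gᗮ := (Submodule.le_orthogonal_iff_le_orthogonal).1 hVG
  have pv : ∀ x, V.starProjection x ∈ V := fun x => starProjection_apply_mem V x
  have pg : ∀ x, G.starProjection x ∈ G := fun x => starProjection_apply_mem G x
  have JP : ∀ x, J (V.starProjection x) = J x := by
    intro x
    have := hJ0 _ (V.sub_starProjection_mem_orthogonal x)
    rw [map_sub, sub_eq_zero] at this
    exact this.symm
  have J'Q : ∀ x, J' (G.starProjection x) = J' x := by
    intro x
    have := hJ'0 _ (G.sub_starProjection_mem_orthogonal x)
    rw [map_sub, sub_eq_zero] at this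
    exact this.symm
  refine ⟨J, J', hs, ?_⟩
  constructor
  · exact fun x => starProjection_eq_self_iff.2 (pv x)
  · exact fun x => starProjection_eq_self_iff.2 (pg x)
  · exact fun x => (starProjection_apply_eq_zero_iff V).2 (hVG (pg x))
  · exact fun x => (starProjection_apply_eq_zero_iff G).2 (hGV (pv x))
  · exact fun x => (starProjection_apply_eq_zero_iff V).2 (hVG (hJ x))
  · exact fun x => starProjection_eq_self_iff.2 (hJ x)
  · exact fun x => starProjection_eq_self_iff.2 (hJ' x)
  · exact fun x => (starProjection_apply_eq_zero_iff G).2 (hGV (hJ' x))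
  · exact fun x => hJ0 _ (hVG (hJ x))
  · exact fun x => hJ'0 _ (hGV (hJ' x))
  · exact JP
  · exact J'Q
  · exact fun x => hJ0 _ (hVG (pg x))
  · exact fun x => hJ'0 _ (hGV (pv x))
  · intro x
    rw [← J'Q x, h2 _ (pg x)]
  · intro x
    rw [← JP x, h1 _ (pv x)]

theorem aux_step_unit {H : Type*} [NormedAddCommGroup H] [InnerProductSpace ℝ H]
    {P M Q J J' : H →L[ℝ] H} (hJ : AuxPIso P Q J J') (hPM : P + M = 1) (α β : ℝ)
    (h : α ^ 2 + β ^ 2 ≠ 0) :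
    IsUnit ((P - M) + ((α - 1) • (P - Q) + β • (J + J'))) := by
  obtain ⟨PP, QQ, PQ, QP, PJ, QJ, PJ', QJ', JJ, J'J', JP, J'Q, JQ, J'P, JJ', J'J⟩ := hJ
  have hM : M = 1 - P := by rw [← hPM]; abel
  have := aux_unit (P - Q) (J + J') (1 - P - Q) α β h ?_ ?_ ?_ ?_ ?_ ?_ ?_ ?_
  · convert this using 1
    rw [hM, sub_smul, one_smul]
    abel
  all_goals
    ext x
    simp [PP, QQ, PQ, QP, PJ, QJ, PJ', QJ', JJ, J'J', JP, J'Q, JQ, J'P, JJ', J'J]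
  all_goals try abel

theorem aux_flowD {H : Type*} [NormedAddCommGroup H] [InnerProductSpace ℝ H]
    {P M : H →L[ℝ] H} (hPM : P + M = 1) (PP : ∀ x, P (P x) = P x)
    (A : ℝ → (H →L[ℝ] H)) (hA : Continuous A) (u : ℝ → H)
    (hu : ∀ t, HasDerivAt u (A t (u t)) t) (a b t₀ t : ℝ)
    (hD : ∀ t ∈ Set.Icc a b, A t = P - M) (h₀ : t₀ = a ∨ t₀ = b) (ht : t ∈ Set.Icc a b) :
    u t = Real.exp (t - t₀) • P (u t₀) + Real.exp (-(t - t₀)) • M (u t₀) := by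
  have hM : M = 1 - P := by rw [← hPM]; abel
  refine aux_unique A hA u
    (fun t => Real.exp (t - t₀) • P (u t₀) + Real.exp (-(t - t₀)) • M (u t₀)) a b
    (fun t _ => hu t) ?_ ?_ ht
  · intro s hs
    rw [hD s hs]
    have h1 : HasDerivAt (fun t => Real.exp (t - t₀)) (Real.exp (s - t₀)) s := by
      simpa using ((hasDerivAt_id s).sub_const t₀).exp
    have h2 : HasDerivAt (fun t => Real.exp (-(t - t₀))) (-Real.exp (-(s - t₀))) s := by
      simpa using (((hasDerivAt_id s).sub_const t₀).neg).exp
    refine ((h1.smul_const (P (u t₀))).add (h2.smul_const (M (u t₀)))).congr_deriv ?_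
    have e1 : P (M (u t₀)) = 0 := by simp [hM, PP]
    have e2 : M (M (u t₀)) = M (u t₀) := by simp [hM, PP]
    have e3 : M (P (u t₀)) = 0 := by simp [hM, PP]
    simp only [sub_apply, map_add, map_smul, e1, e2, e3, PP]
    module
  · have e : u t₀ = Real.exp (t₀ - t₀) • P (u t₀) + Real.exp (-(t₀ - t₀)) • M (u t₀) := by
      simp [hM]
    rcases h₀ with rfl | rfl
    · exact Or.inl e
    · exact Or.inr e

theorem aux_tendsto_top {H : Type*} [NormedAddCommGroup H] [InnerProductSpace ℝ H]
    {P M : H →L[ℝ] H} (hPM : P + M = 1) (PP : ∀ x, P (P x) = P x)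
    (u : ℝ → H) (x : H) (t₀ : ℝ)
    (hu : ∀ t, t₀ ≤ t → u t = Real.exp (t - t₀) • P x + Real.exp (-(t - t₀)) • M x) :
    Tendsto u atTop (nhds 0) ↔ P x = 0 := by
  have hM : M = 1 - P := by rw [← hPM]; abel
  have hev : u =ᶠ[atTop] fun t => Real.exp (t - t₀) • P x + Real.exp (-(t - t₀)) • M x := by
    filter_upwards [eventually_ge_atTop t₀] with t ht using hu t ht
  have hlim : Tendsto (fun t : ℝ => Real.exp (-(t - t₀))) atTop (nhds 0) :=
    Real.tendsto_exp_neg_atTop_nhds_zero.comp (tendsto_atTop_add_const_right _ (-t₀) tendsto_id)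
  rw [tendsto_congr' hev]
  constructor
  · intro h
    have h1 := hlim.smul (((P.continuous.tendsto _).comp h))
    have h2 : Tendsto (fun _ : ℝ => P x) atTop (nhds ((0 : ℝ) • P 0)) := by
      refine h1.congr ?_
      intro t
      simp [hM, PP, smul_smul, ← Real.exp_add]
    rw [zero_smul] at h2
    exact tendsto_nhds_unique tendsto_const_nhds h2
  · intro h
    simpa [h] using hlim.smul_const (M x)

theorem aux_tendsto_bot {H : Type*} [NormedAddCommGroup H] [InnerProductSpace ℝ H]
    {P M : H →L[ℝ] H} (hPM : P + M = 1) (PP : ∀ x, P (P x) = P x)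
    (u : ℝ → H) (x : H)
    (hu : ∀ t, t ≤ 0 → u t = Real.exp (t - 0) • P x + Real.exp (-(t - 0)) • M x) :
    Tendsto u atBot (nhds 0) ↔ M x = 0 := by
  have hM : M = 1 - P := by rw [← hPM]; abel
  rw [← aux_tendsto_top (P := M) (M := P) (by rw [add_comm]; exact hPM) (by simp [hM, PP])
    (fun t => u (-t)) x 0 ?_]
  · constructor
    · intro h
      exact h.comp tendsto_neg_atTop_atBot
    · intro h
      have := h.comp tendsto_neg_atBot_atTop
      simpa [Function.comp_def] using this
  · intro t ht
    show u (-t) = _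
    rw [hu (-t) (by linarith)]
    simp [add_comm]

theorem aux_action {H : Type*} [NormedAddCommGroup H] [InnerProductSpace ℝ H]
    {P M Q J J' : H →L[ℝ] H} (hJ : AuxPIso P Q J J') (hPM : P + M = 1) (α β p q r : ℝ)
    (z w : H) (hz : P z = z) (hw : P w = 0) (hw' : Q w = 0) :
    ((P - M) + ((α - 1) • (P - Q) + β • (J + J'))) (p • z + q • J z + r • w)
      = (α * p + β * q) • z + (β * p - α * q) • J z + (- r) • w := by
  obtain ⟨PP, QQ, PQ, QP, PJ, QJ, PJ', QJ', JJ, J'J', JP, J'Q, JQ, J'P, JJ', J'J⟩ := hJ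
  have hM : M = 1 - P := by rw [← hPM]; abel
  have h1 : Q z = 0 := by rw [← hz, QP]
  have h2 : J' z = 0 := by rw [← hz, J'P]
  have h3 : J w = 0 := by rw [← JP, hw, map_zero]
  have h4 : J' w = 0 := by rw [← J'Q, hw', map_zero]
  simp [hM, hz, hw, hw', h1, h2, h3, h4, PJ, QJ, JJ, J'J]
  module

/-- Given an orthogonal splitting `H = H⁻ ⊕ H⁺` of a separable
infinite-dimensional real Hilbert space into infinite-dimensional subspaces, for every
`k` there exists a smooth path `A` of self-adjoint invertible operators, equal to
`P⁺ - P⁻` outside `(0,1)`, such that the solution of `X' = AX`, `X(0) = 1` has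
stable and unstable spaces with `W^s + W^u = H` and `dim (W^s ∩ W^u) = k`. -/
theorem exists_path_with_prescribed_stable_unstable_intersection
    {H : Type*} [NormedAddCommGroup H] [InnerProductSpace ℝ H] [CompleteSpace H]
    [TopologicalSpace.SeparableSpace H] (hinf : ¬ FiniteDimensional ℝ H)
    (Hm Hp : Submodule ℝ H)
    (hm : IsClosed (Hm : Set H)) (hp : IsClosed (Hp : Set H))
    (hsplit : Hp = Hmᗮ)
    (hmdim : ¬ FiniteDimensional ℝ Hm) (hpdim : ¬ FiniteDimensional ℝ Hp)
    (k : ℕ) :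
    ∃ A : ℝ → (H →L[ℝ] H),
      ContDiff ℝ (⊤ : ℕ∞) A ∧
      (∀ t, IsSelfAdjoint (A t)) ∧
      (∀ t, IsUnit (A t)) ∧
      (∀ t ∉ Set.Ioo (0 : ℝ) 1, A t = orthProjL Hp hp - orthProjL Hm hm) ∧
      ∀ X : ℝ → (H →L[ℝ] H),
        X 0 = 1 →
        (∀ t, HasDerivAt X ((A t).comp (X t)) t) →
        stableSpace X ⊔ unstableSpace X = ⊤ ∧
        FiniteDimensional ℝ ↥(stableSpace X ⊓ unstableSpace X) ∧
        finrank ℝ ↥(stableSpace X ⊓ unstableSpace X) = k := by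
  have : CompleteSpace Hm := hm.completeSpace_coe
  have : CompleteSpace Hp := hp.completeSpace_coe
  have eP : orthProjL Hp hp = Hp.starProjection := rfl
  have eM : orthProjL Hm hm = Hm.starProjection := rfl
  rw [eP, eM]
  have hsplit' : Hm = Hpᗮ := by rw [hsplit, Submodule.orthogonal_orthogonal]
  obtain ⟨E, hE, hEfd, hEk⟩ := aux_finsub Hm hm hmdim k
  set G : Submodule ℝ H := Hm ⊓ Eᗮ with hG
  have hGc : IsClosed (G : Set H) := by
    rw [hG, Submodule.coe_inf]
    exact hm.inter E.isClosed_orthogonal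
  have : CompleteSpace G := hGc.completeSpace_coe
  have hGfd : ¬ FiniteDimensional ℝ G := by
    intro hfd
    apply hmdim
    have hle : Hm ≤ E ⊔ G := by
      intro y hy
      have h1 := starProjection_apply_mem E y
      have h2 : y - E.starProjection y ∈ G :=
        ⟨Hm.sub_mem hy (hE h1), E.sub_starProjection_mem_orthogonal y⟩
      have := Submodule.add_mem_sup h1 h2
      simpa using this
    exact Submodule.finiteDimensional_of_le hle
  obtain ⟨J, J', hJs, hJ⟩ := aux_piso Hp Hm hsplit'.le hpdim hmdim
  obtain ⟨K, K', hKs, hK⟩ := aux_piso Hp G (inf_le_left.trans hsplit'.le) hpdim hGfd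
  -- facts about the projections
  have hQE : ∀ y ∈ Hm, y - G.starProjection y ∈ E := by
    intro y hy
    have h1 := starProjection_apply_mem E y
    have h2 : y - E.starProjection y ∈ G :=
      ⟨Hm.sub_mem hy (hE h1), E.sub_starProjection_mem_orthogonal y⟩
    have h3 : y - E.starProjection y = G.starProjection y := by
      refine (eq_starProjection_of_mem_orthogonal h2 ?_).symm
      have h4 : E ≤ Gᗮ := (Submodule.le_orthogonal_iff_le_orthogonal).1 inf_le_right
      simpa using h4 h1
    rw [← h3]
    simp
  have hQE0 : ∀ y ∈ E, G.starProjection y = 0 := by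
    intro y hy
    have h4 : E ≤ Gᗮ := (Submodule.le_orthogonal_iff_le_orthogonal).1 inf_le_right
    exact (starProjection_apply_eq_zero_iff G).2 (h4 hy)
  have hPM : Hp.starProjection + Hm.starProjection = 1 := by
    have := starProjection_orthogonal' Hm
    subst hsplit
    ext x
    simp [this]
  have hP1 : ∀ x, Hp.starProjection x = x ↔ x ∈ Hp := fun x => starProjection_eq_self_iff
  have hP0 : ∀ x, Hp.starProjection x = 0 ↔ x ∈ Hm := fun x => by
    rw [starProjection_apply_eq_zero_iff, ← hsplit']
  have hM0 : ∀ x, Hm.starProjection x = 0 ↔ x ∈ Hp := fun x => by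
    rw [starProjection_apply_eq_zero_iff, ← hsplit]
  have hM1 : ∀ x, Hm.starProjection x = x ↔ x ∈ Hm := fun x => starProjection_eq_self_iff
  have sP : IsSelfAdjoint Hp.starProjection := isSelfAdjoint_starProjection Hp
  have sM : IsSelfAdjoint Hm.starProjection := isSelfAdjoint_starProjection Hm
  have sQ : IsSelfAdjoint G.starProjection := isSelfAdjoint_starProjection G
  generalize Hp.starProjection = P at *
  generalize Hm.starProjection = M at *
  generalize G.starProjection = Q at *
  obtain ⟨α, β, p, q, sα, sβ, hαβ, hout, hp', hq', p0, q0, p1, q1⟩ := aux_step1 0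
  obtain ⟨γ, δ, f, g, sγ, sδ, hγδ, hout', hf', hg', f0, g0, f1, g1⟩ := aux_step2 (1/2)
  rw [zero_add] at hout p1 q1
  rw [add_halves] at hout' f1 g1
  set B : ℝ → (H →L[ℝ] H) := fun t => (α t - 1) • (P - M) + β t • (J + J') with hB
  set C : ℝ → (H →L[ℝ] H) := fun t => (γ t - 1) • (P - Q) + δ t • (K + K') with hC
  have hB0 : ∀ t ∉ Set.Ioo (0 : ℝ) (1/2), B t = 0 := by
    intro t ht
    obtain ⟨h1, h2⟩ := hout t ht
    simp [hB, h1, h2]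
  have hC0 : ∀ t ∉ Set.Ioo (1/2 : ℝ) 1, C t = 0 := by
    intro t ht
    obtain ⟨h1, h2⟩ := hout' t ht
    simp [hC, h1, h2]
  have hA0 : ∀ t ∉ Set.Ioo (0 : ℝ) 1, P - M + B t + C t = P - M := by
    intro t ht
    rw [hB0 t (fun h => ht ⟨h.1, by linarith [h.2]⟩),
      hC0 t (fun h => ht ⟨by linarith [h.1], h.2⟩)]
    simp
  have hA1 : ∀ t, t ≤ 1/2 → P - M + B t + C t = P - M + B t := by
    intro t ht
    rw [hC0 t (fun h => by linarith [h.1])]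
    simp
  have hA2 : ∀ t, 1/2 ≤ t → P - M + B t + C t = P - M + C t := by
    intro t ht
    rw [hB0 t (fun h => by linarith [h.2])]
    simp
  have hsm : ContDiff ℝ (⊤ : ℕ∞) (fun t => P - M + B t + C t) := by
    simp only [hB, hC]
    fun_prop
  refine ⟨fun t => P - M + B t + C t, hsm, ?_, ?_, hA0, ?_⟩
  · intro t
    have tr : ∀ c : ℝ, IsSelfAdjoint c := fun c => IsSelfAdjoint.all c
    exact ((sP.sub sM).add (((tr _).smul (sP.sub sM)).add ((tr _).smul hJs))).add
      (((tr _).smul (sP.sub sQ)).add ((tr _).smul hKs))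
  · intro t
    rcases le_total t (1/2) with h | h
    · simp only [hA1 t h]
      exact aux_step_unit hJ hPM _ _ (hαβ t)
    · simp only [hA2 t h]
      exact aux_step_unit hK hPM _ _ (hγδ t)
  intro X hX0 hX
  have hXx : ∀ x t, HasDerivAt (fun t => X t x) ((P - M + B t + C t) (X t x)) t := by
    intro x t
    simpa using (hX t).clm_apply (hasDerivAt_const t x)
  have hu : ∀ x, x ∈ unstableSpace X ↔ x ∈ Hp := by
    intro x
    rw [← hM0]
    refine aux_tendsto_bot hPM hJ.PP (fun t => X t x) x ?_
    intro t ht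
    have := aux_flowD hPM hJ.PP _ hsm.continuous (fun t => X t x) (hXx x) t 0 0 t
      (fun s hs => hA0 s (fun h => by linarith [h.1, hs.2])) (Or.inr rfl) ⟨le_rfl, ht⟩
    simpa [hX0] using this
  have hs : ∀ x, x ∈ stableSpace X ↔ X 1 x ∈ Hm := by
    intro x
    rw [← hP0]
    refine aux_tendsto_top hPM hJ.PP (fun t => X t x) (X 1 x) 1 ?_
    intro t ht
    exact aux_flowD hPM hJ.PP _ hsm.continuous (fun t => X t x) (hXx x) 1 t 1 t
      (fun s hs => hA0 s (fun h => by linarith [h.2, hs.1])) (Or.inl rfl) ⟨ht, le_rfl⟩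
  have hhalf : ∀ x ∈ Hp, X (1/2) x = Real.exp (-(1/2)) • J x := by
    intro x hx
    have := aux_unique _ hsm.continuous (fun t => X t x)
      (fun t => p t • x + q t • J x) 0 (1/2) (fun t _ => hXx x t) ?_ (Or.inl ?_)
      (Set.right_mem_Icc.2 (by norm_num))
    · simp only [p1, q1, zero_smul, zero_add] at this
      exact this
    · intro t ht
      have e := aux_action hJ hPM (α t) (β t) (p t) (q t) 0 x 0 ((hP1 x).2 hx) (map_zero _)
        (map_zero _)
      simp only [smul_zero, add_zero] at e
      simp only [hA1 t ht.2]
      refine (((hp' t).smul_const x).add ((hq' t).smul_const (J x))).congr_deriv ?_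
      exact e.symm
    · simp [hX0, p0, q0]
  have hJm : ∀ x, J x ∈ Hm := fun x => (hM1 _).1 (hJ.QJ x)
  have hone : ∀ x ∈ Hp, X 1 x = Real.exp 1 • K' (J x) + Real.exp (-1) • (J x - Q (J x)) := by
    intro x hx
    have := aux_unique _ hsm.continuous (fun t => X t x)
      (fun t => f t • K' (J x) + g t • K (K' (J x)) + Real.exp (-t) • (J x - Q (J x)))
      (1/2) 1 (fun t _ => hXx x t) ?_ (Or.inl ?_)
      (Set.right_mem_Icc.2 (by norm_num))
    · simpa [f1, g1] using this
    · intro t ht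
      have e := aux_action hK hPM (γ t) (δ t) (f t) (g t) (Real.exp (-t)) (K' (J x))
        (J x - Q (J x)) (hK.PJ' _) (by rw [map_sub, hJ.PJ, hK.PQ, sub_zero])
        (by rw [map_sub, hK.QQ, sub_self])
      simp only [hA2 t ht.1]
      have hexp : HasDerivAt (fun t => Real.exp (-t)) (-Real.exp (-t)) t := by
        simpa using (hasDerivAt_neg t).exp
      refine ((((hf' t).smul_const _).add ((hg' t).smul_const _)).add
        (hexp.smul_const _)).congr_deriv ?_
      exact e.symm
    · simp only [hhalf x hx, f0, g0, hK.JJ', zero_smul, zero_add, ← smul_add]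
      simp
  have hEm : ∀ x, J x - Q (J x) ∈ Hm := fun x => hE (hQE _ (hJm x))
  have hKp : ∀ x, K' x ∈ Hp := fun x => (hP1 _).1 (hK.PJ' x)
  have hJp : ∀ x, J' x ∈ Hp := fun x => (hP1 _).1 (hJ.PJ' x)
  have hJJ' : ∀ y ∈ Hm, J (J' y) = y := fun y hy => by rw [hJ.JJ', (hM1 y).2 hy]
  have hWmap : stableSpace X ⊓ unstableSpace X = LinearMap.range
      ((J' : H →ₗ[ℝ] H).domRestrict E) := by
    ext x
    rw [Submodule.mem_inf, hs, hu, LinearMap.mem_range]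
    constructor
    · rintro ⟨h1, h2⟩
      rw [hone x h2] at h1
      have h3 : K' (J x) ∈ Hm := by
        have h4 := Hm.sub_mem h1 (Hm.smul_mem (Real.exp (-1)) (hEm x))
        rw [add_sub_cancel_right] at h4
        exact (Hm.smul_mem_iff (Real.exp_ne_zero 1)).1 h4
      have h5 : K' (J x) = 0 := by
        rw [← (hP1 _).2 (hKp (J x)), (hP0 _).2 h3]
      have h6 : Q (J x) = 0 := by rw [← hK.JJ', h5, map_zero]
      have h7 := hQE _ (hJm x)
      rw [h6, sub_zero] at h7
      refine ⟨⟨J x, h7⟩, ?_⟩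
      simp [hJ.J'J, (hP1 x).2 h2]
    · rintro ⟨⟨y, hy⟩, rfl⟩
      have e : ((J' : H →ₗ[ℝ] H).domRestrict E) ⟨y, hy⟩ = J' y := rfl
      rw [e]
      refine ⟨?_, hJp y⟩
      rw [hone _ (hJp y), hJJ' y (hE hy), ← hK.J'Q, hQE0 y hy]
      simpa using Hm.smul_mem _ (hE hy)
  have hinj : Function.Injective ((J' : H →ₗ[ℝ] H).domRestrict E) := by
    rintro ⟨y, hy⟩ ⟨z, hz⟩ h
    have h1 : J' y = J' z := h
    have h2 := congrArg J h1
    rw [hJJ' y (hE hy), hJJ' z (hE hz)] at h2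
    exact Subtype.ext h2
  refine ⟨?_, ?_, ?_⟩
  · rw [eq_top_iff]
    rintro x -
    set a : H := J' (K (P (X 1 x))) with ha
    set ξ : H := Real.exp (-1) • a with hξ
    have hξp : ξ ∈ Hp := Hp.smul_mem _ (hJp _)
    have hKm : K (P (X 1 x)) ∈ Hm := by
      rw [← hP0, hK.PJ]
    have hJa : J a = K (P (X 1 x)) := hJJ' _ hKm
    have h1 : X 1 ξ = P (X 1 x) := by
      rw [hone ξ hξp, hξ, map_smul, hJa]
      simp only [map_smul, hK.J'J, hK.QJ, hK.PP, sub_self, smul_zero, add_zero, smul_smul,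
        ← Real.exp_add]
      simp
    have h2 : x - ξ ∈ stableSpace X := by
      rw [hs, map_sub, h1, ← hP0, map_sub, hJ.PP, sub_self]
    have := Submodule.add_mem_sup h2 ((hu ξ).2 hξp)
    simpa using this
  · rw [hWmap]; infer_instance
  · rw [hWmap, LinearMap.finrank_range_of_inj hinj, hEk]
end

section
/- Let H be a real Hilbert space, let (V,Z) be a Fredholm pair of closed linear subspaces of H, and let W be a compact perturbation of V. Then (W,Z) is a Fredholm pair, and ind(W,Z) = ind(V,Z) + dim(W,V). -/
open Module Submodule

variable {H : Type*} [NormedAddCommGroup H] [InnerProductSpace ℝ H] [CompleteSpace H]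

/-- `W` is a compact perturbation of `V` if the difference of the corresponding
orthogonal projections is a compact operator. -/
def IsCompactPerturbation (W V : Submodule ℝ H) (hW : IsClosed (W : Set H))
    (hV : IsClosed (V : Set H)) : Prop :=
  IsCompactOperator (⇑(orthProjL W hW - orthProjL V hV))

/-- The relative dimension `dim(W,V) = dim (W ⊓ Vᗮ) - dim (Wᗮ ⊓ V)` of a compact
perturbation `W` of `V`. -/
noncomputable def relDim (W V : Submodule ℝ H) : ℤ :=
  (finrank ℝ ↥(W ⊓ Vᗮ) : ℤ) - (finrank ℝ ↥(Wᗮ ⊓ V) : ℤ)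

/-- `(V, W)` is a Fredholm pair: `V ⊓ W` is finite dimensional and `V ⊔ W` is closed
and finite codimensional. -/
def IsFredholmPair (V W : Submodule ℝ H) : Prop :=
  FiniteDimensional ℝ ↥(V ⊓ W) ∧ IsClosed (((V ⊔ W) : Submodule ℝ H) : Set H) ∧
    FiniteDimensional ℝ (H ⧸ (V ⊔ W))

/-- The index `ind (V, W) = dim (V ⊓ W) - codim (V ⊔ W)` of a Fredholm pair. -/
noncomputable def fpIndex (V W : Submodule ℝ H) : ℤ :=
  (finrank ℝ ↥(V ⊓ W) : ℤ) - (finrank ℝ (H ⧸ (V ⊔ W)) : ℤ)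

/-- Algebraic Fredholm property: finite-dimensional kernel and cokernel. -/
def AlgFred {E F : Type*} [AddCommGroup E] [Module ℝ E] [AddCommGroup F] [Module ℝ F]
    (f : E →ₗ[ℝ] F) : Prop :=
  FiniteDimensional ℝ (LinearMap.ker f) ∧ FiniteDimensional ℝ (F ⧸ LinearMap.range f)

section Alg

variable {E F G : Type*} [AddCommGroup E] [Module ℝ E] [AddCommGroup F] [Module ℝ F]
  [AddCommGroup G] [Module ℝ G]

theorem AlgFred.comp {f : E →ₗ[ℝ] F} {g : F →ₗ[ℝ] G} (hf : AlgFred f) (hg : AlgFred g) :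
    AlgFred (g ∘ₗ f) := by
  have := hf.1
  have := hf.2
  have := hg.1
  have := hg.2
  constructor
  · rw [LinearMap.ker_comp]; infer_instance
  · rw [LinearMap.range_comp]; infer_instance

theorem AlgFred.index_comp {f : E →ₗ[ℝ] F} {g : F →ₗ[ℝ] G} (hf : AlgFred f) (hg : AlgFred g) :
    (g ∘ₗ f).index = g.index + f.index := by
  have := hf.1
  have := hf.2
  have := hg.1
  have := hg.2
  exact LinearMap.index_comp g

theorem algFred_of_comp {f : E →ₗ[ℝ] F} {g : F →ₗ[ℝ] E} {g' : F →ₗ[ℝ] E}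
    (h1 : AlgFred (g ∘ₗ f)) (h2 : AlgFred (f ∘ₗ g')) : AlgFred f := by
  have := h1.1
  have := h2.2
  constructor
  · exact Submodule.finiteDimensional_of_le (LinearMap.ker_le_ker_comp f g)
  · exact Module.Finite.of_surjective _
      (Submodule.factor_surjective (LinearMap.range_comp_le_range g' f))

theorem algFred_of_comp_right {f : E →ₗ[ℝ] F} {g : F →ₗ[ℝ] G}
    (hf : AlgFred f) (h : AlgFred (g ∘ₗ f)) : AlgFred g := by
  have := hf.2
  have := h.1
  have := h.2
  constructor
  · let φ : LinearMap.ker g →ₗ[ℝ] F ⧸ LinearMap.range f :=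
      (LinearMap.range f).mkQ ∘ₗ (LinearMap.ker g).subtype
    have hφ : FiniteDimensional ℝ (LinearMap.ker φ) := by
      let ψ : LinearMap.ker (g ∘ₗ f) →ₗ[ℝ] F := f ∘ₗ (LinearMap.ker (g ∘ₗ f)).subtype
      have hle : (LinearMap.ker φ).map (LinearMap.ker g).subtype ≤ LinearMap.range ψ := by
        rintro _ ⟨⟨y, hy⟩, hy2, rfl⟩
        have : y ∈ LinearMap.range f := by simpa [φ] using hy2
        obtain ⟨x, rfl⟩ := this
        exact ⟨⟨x, hy⟩, rfl⟩
      have := Submodule.finiteDimensional_of_le hle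
      exact (Submodule.equivSubtypeMap _ (LinearMap.ker φ)).symm.finiteDimensional
    have : FiniteDimensional ℝ (LinearMap.ker g ⧸ LinearMap.ker φ) :=
      φ.quotKerEquivRange.symm.finiteDimensional
    exact Module.Finite.of_submodule_quotient (LinearMap.ker φ)
  · exact Module.Finite.of_surjective _
      (Submodule.factor_surjective (LinearMap.range_comp_le_range f g))

theorem algFred_equiv (e : E ≃ₗ[ℝ] F) : AlgFred e.toLinearMap := by
  constructor
  · rw [LinearEquiv.ker]; infer_instance
  · rw [LinearEquiv.range]; infer_instance

theorem algFred_id_add_finite {f : E →ₗ[ℝ] E} (hf : f.HasFiniteRange) :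
    AlgFred (LinearMap.id + f) ∧ (LinearMap.id + f).index = 0 := by
  have hfd : FiniteDimensional ℝ (LinearMap.range f) := Module.Finite.of_fg hf
  set R := LinearMap.range f with hR
  let g : R →ₗ[ℝ] R := LinearMap.id + f.rangeRestrict ∘ₗ R.subtype
  have hg : ∀ r : R, ((g r : R) : E) = (LinearMap.id + f : E →ₗ[ℝ] E) (r : E) := fun r => by
    simp [g]
  have hker : LinearMap.ker (LinearMap.id + f) = (LinearMap.ker g).map R.subtype := by
    ext x
    simp only [LinearMap.mem_ker, Submodule.mem_map, Submodule.subtype_apply]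
    constructor
    · intro hx
      have hxR : x ∈ R := ⟨-x, by
        have : x + f x = 0 := by simpa using hx
        rw [map_neg]; exact (eq_neg_of_add_eq_zero_left this).symm⟩
      refine ⟨⟨x, hxR⟩, ?_, rfl⟩
      apply Subtype.ext
      rw [hg]; exact hx
    · rintro ⟨r, hr, rfl⟩
      rw [← hg, hr]; rfl
  let q : R →ₗ[ℝ] E ⧸ LinearMap.range (LinearMap.id + f) :=
    (LinearMap.range (LinearMap.id + f)).mkQ ∘ₗ R.subtype
  have hqs : Function.Surjective q := by
    intro y
    obtain ⟨x, rfl⟩ := Submodule.mkQ_surjective _ y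
    refine ⟨⟨-f x, ⟨-x, by simp⟩⟩, ?_⟩
    simp only [q, LinearMap.comp_apply, Submodule.subtype_apply, Submodule.mkQ_apply]
    rw [Submodule.Quotient.eq]
    refine ⟨-x, ?_⟩
    simp
    abel
  have hqk : LinearMap.ker q = LinearMap.range g := by
    ext r
    simp only [q, LinearMap.ker_comp, Submodule.ker_mkQ, Submodule.mem_comap, LinearMap.mem_range,
      Submodule.subtype_apply]
    constructor
    · rintro ⟨x, hx⟩
      have hx' : x + f x = r := by simpa using hx
      have hxR : x ∈ R := by
        rw [eq_sub_of_add_eq hx']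
        exact R.sub_mem r.2 ⟨x, rfl⟩
      exact ⟨⟨x, hxR⟩, Subtype.ext (by rw [hg]; exact hx)⟩
    · rintro ⟨x, rfl⟩
      exact ⟨x, (hg x).symm⟩
  have e := (Submodule.quotEquivOfEq _ _ hqk).symm.trans (q.quotKerEquivOfSurjective hqs)
  have h1 : FiniteDimensional ℝ (LinearMap.ker (LinearMap.id + f)) := by
    rw [hker]; infer_instance
  refine ⟨⟨h1, Module.Finite.of_surjective q hqs⟩, ?_⟩
  have := LinearMap.index_eq_of_finiteDimensional (f := g)
  rw [LinearMap.index_eq_finrank_sub] at this ⊢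
  rw [← e.finrank_eq, hker, Submodule.finrank_map_subtype_eq, this, sub_self]

end Alg

section Hilb

variable {E F : Type*} [NormedAddCommGroup E] [InnerProductSpace ℝ E] [CompleteSpace E]
  [NormedAddCommGroup F] [InnerProductSpace ℝ F] [CompleteSpace F]

theorem exists_finite_approx (C : E →L[ℝ] E) (hC : IsCompactOperator C) :
    ∃ S : E →L[ℝ] E, S.toLinearMap.HasFiniteRange ∧ ‖S - C‖ < 1 := by
  obtain ⟨K, hK, hK'⟩ := hC.image_closedBall_subset_compact (f := C.toLinearMap) 1
  obtain ⟨t, ht, htK⟩ := Metric.totallyBounded_iff.1 hK.totallyBounded (1/2) (by norm_num)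
  let U := Submodule.span ℝ t
  have : FiniteDimensional ℝ U := FiniteDimensional.span_of_finite ℝ ht
  refine ⟨U.starProjection ∘L C, ?_, ?_⟩
  · have : (LinearMap.range (U.starProjection ∘L C).toLinearMap) ≤ U := by
      rintro _ ⟨x, rfl⟩
      simp
    have h2 := Submodule.finiteDimensional_of_le this
    exact (Submodule.fg_iff_finiteDimensional _).2 h2
  · refine lt_of_le_of_lt (b := 1/2) ?_ (by norm_num)
    refine ContinuousLinearMap.opNorm_le_of_unit_norm (by norm_num) ?_
    intro x hx
    have hCx : C x ∈ K := hK' ⟨x, by simp [hx], rfl⟩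
    obtain ⟨y, hy, hxy⟩ := Set.mem_iUnion₂.1 (htK hCx)
    rw [sub_apply, norm_sub_rev, ContinuousLinearMap.comp_apply,
      Submodule.starProjection_minimal]
    refine (ciInf_le ⟨0, ?_⟩ (⟨y, Submodule.subset_span hy⟩ : U)).trans ?_
    · rintro _ ⟨z, rfl⟩
      exact norm_nonneg _
    · rw [Metric.mem_ball, dist_eq_norm] at hxy
      exact hxy.le

theorem algFred_id_add_compact (C : E →L[ℝ] E) (hC : IsCompactOperator C) :
    AlgFred (LinearMap.id + C.toLinearMap) ∧ (LinearMap.id + C.toLinearMap).index = 0 := by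
  obtain ⟨S, hS, hn⟩ := exists_finite_approx C hC
  obtain ⟨u, hu⟩ := isUnit_one_sub_of_norm_lt_one hn
  let e := ContinuousLinearEquiv.unitsEquiv ℝ E u
  have he : ∀ x, e x = x - (S x - C x) := fun x => by
    change (u : E →L[ℝ] E) x = _
    rw [hu]; simp
  let f : E →ₗ[ℝ] E := e.symm.toLinearEquiv.toLinearMap ∘ₗ S.toLinearMap
  have hf : f.HasFiniteRange := hS.comp_left _
  have heq : LinearMap.id + C.toLinearMap = e.toLinearEquiv.toLinearMap ∘ₗ (LinearMap.id + f) := by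
    ext x
    have : e (x + e.symm (S x)) = x + C x := by
      rw [map_add, e.apply_symm_apply, he]; abel
    exact this.symm
  obtain ⟨h1, h2⟩ := algFred_id_add_finite hf
  rw [heq]
  refine ⟨h1.comp (algFred_equiv _), ?_⟩
  rw [h1.index_comp (algFred_equiv _), h2, LinearEquiv.index_eq_zero, add_zero]

theorem AlgFred.isClosed_range {T : E →L[ℝ] F} (hT : AlgFred T.toLinearMap) :
    IsClosed (LinearMap.range T.toLinearMap : Set F) := by
  have := hT.2
  obtain ⟨G, hG⟩ := (LinearMap.range T.toLinearMap).exists_isCompl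
  have hGf : FiniteDimensional ℝ G := (Submodule.quotientEquivOfIsCompl _ _ hG).finiteDimensional
  have : CompleteSpace (LinearMap.ker T.toLinearMap) := T.isClosed_ker.completeSpace_coe
  let T1 : (LinearMap.ker T.toLinearMap)ᗮ →L[ℝ] F := T ∘L Submodule.subtypeL _
  have hr : LinearMap.range T1.toLinearMap = LinearMap.range T.toLinearMap := by
    apply le_antisymm
    · exact LinearMap.range_comp_le_range _ _
    · rintro _ ⟨x, rfl⟩
      refine ⟨(LinearMap.ker T.toLinearMap)ᗮ.orthogonalProjectionOnto x, ?_⟩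
      have h3 : T ((LinearMap.ker T.toLinearMap).starProjection x) = 0 :=
        ((LinearMap.ker T.toLinearMap).orthogonalProjectionOnto x).2
      simp [T1, Submodule.orthogonalProjectionOnto_orthogonal, h3]
  have := ContinuousLinearMap.closed_complemented_range_of_isCompl_of_ker_eq_bot T1 G
    (by rw [hr]; exact hG) G.closed_of_finiteDimensional (by
      rw [LinearMap.ker_eq_bot']
      rintro ⟨x, hx⟩ h
      have h' : T x = 0 := h
      have hx2 : x ∈ LinearMap.ker T.toLinearMap := h'
      apply Subtype.ext
      exact inner_self_eq_zero.1 (hx x hx2))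
  rwa [hr] at this

theorem AlgFred.isFredholm {T : E →L[ℝ] F} (hT : AlgFred T.toLinearMap) : T.IsFredholm := by
  have hcl := hT.isClosed_range
  have := hT.1
  have := hT.2
  have : CompleteSpace (LinearMap.range T.toLinearMap) := hcl.completeSpace_coe
  have : CompleteSpace (LinearMap.ker T.toLinearMap) := T.isClosed_ker.completeSpace_coe
  have hco : ((LinearMap.ker T.toLinearMap)ᗮ).CoFG := 
    (Submodule.quotientEquivOfIsCompl _ _ 
      (LinearMap.ker T.toLinearMap).isCompl_orthogonal.symm).symm.finiteDimensional
  have hm : Set.MapsTo T ((LinearMap.ker T.toLinearMap)ᗮ : Submodule ℝ E)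
    (LinearMap.range T.toLinearMap) := fun x _ => ⟨x, rfl⟩
  refine ContinuousLinearMap.IsFredholm.of_isInvertible_restrict
    (Submodule.isClosed_orthogonal _) hcl hm ?_
  refine ⟨ContinuousLinearEquiv.ofBijective (T.restrict hm) ?_ ?_, ?_⟩
  · rw [LinearMap.ker_eq_bot']
    rintro ⟨x, hx⟩ h
    have h' : T x = 0 := congrArg Subtype.val h
    have hx2 : x ∈ LinearMap.ker T.toLinearMap := h'
    apply Subtype.ext
    exact inner_self_eq_zero.1 (hx x hx2)
  · rw [LinearMap.range_eq_top]
    rintro ⟨_, ⟨x, rfl⟩⟩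
    refine ⟨(LinearMap.ker T.toLinearMap)ᗮ.orthogonalProjectionOnto x, ?_⟩
    have h3 : T ((LinearMap.ker T.toLinearMap).starProjection x) = 0 :=
      ((LinearMap.ker T.toLinearMap).orthogonalProjectionOnto x).2
    apply Subtype.ext
    change T _ = T x
    simp [Submodule.orthogonalProjectionOnto_orthogonal, h3]
  · exact ContinuousLinearEquiv.coe_ofBijective _ _ _

theorem isCompact_of_finite {f : E →L[ℝ] F} (hf : f.toLinearMap.HasFiniteRange) :
    IsCompactOperator f := by
  have : FiniteDimensional ℝ (LinearMap.range f.toLinearMap) := Module.Finite.of_fg hf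
  have h1 : IsCompactOperator (LinearMap.range f.toLinearMap).subtypeL :=
    isCompactOperator_of_locallyCompactSpace_rng _
  exact h1.comp_clm (f.codRestrict _ fun x => ⟨x, rfl⟩)

theorem AlgFred.add_compact {T K : E →L[ℝ] F} (hT : AlgFred T.toLinearMap)
    (hK : IsCompactOperator K) :
    AlgFred (T + K).toLinearMap ∧ (T + K).toLinearMap.index = T.toLinearMap.index := by
  obtain ⟨Q, hQ⟩ := hT.isFredholm.exists_isQuasiInverse
  have hQF := ContinuousLinearMap.IsFredholm.of_isQuasiInverse hQ.symm
  have hQA : AlgFred Q.toLinearMap := ⟨hQF.finite_ker, hQF.finite_coker⟩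
  have h1 := LinearMap.FiniteRangeSetoid.equiv_iff_hasFiniteRange.1 hQ.1
  have h2 := LinearMap.FiniteRangeSetoid.equiv_iff_hasFiniteRange.1 hQ.2
  have c1 := isCompact_of_finite (f := Q ∘L T - .id ℝ E) h1
  have c2 := isCompact_of_finite (f := T ∘L Q - .id ℝ F) h2
  have d0 := algFred_id_add_compact _ c1
  have d1 := algFred_id_add_compact (Q ∘L T - .id ℝ E + Q ∘L K) (c1.add (hK.clm_comp Q))
  have d2 := algFred_id_add_compact (T ∘L Q - .id ℝ F + K ∘L Q) (c2.add (hK.comp_clm Q))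
  have e0 : LinearMap.id + (Q ∘L T - .id ℝ E).toLinearMap = Q.toLinearMap ∘ₗ T.toLinearMap := by
    ext x; simp
  have e1 : LinearMap.id + (Q ∘L T - .id ℝ E + Q ∘L K).toLinearMap
      = Q.toLinearMap ∘ₗ (T + K).toLinearMap := by
    ext x; simp; abel
  have e2 : LinearMap.id + (T ∘L Q - .id ℝ F + K ∘L Q).toLinearMap
      = (T + K).toLinearMap ∘ₗ Q.toLinearMap := by
    ext x; simp; abel
  rw [e0] at d0
  rw [e1] at d1
  rw [e2] at d2
  have hTK := algFred_of_comp d1.1 d2.1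
  refine ⟨hTK, ?_⟩
  have i0 := hT.index_comp hQA
  have i1 := hTK.index_comp hQA
  rw [d0.2] at i0
  rw [d1.2] at i1
  linarith

end Hilb
section Pair

/-- The operator `V → Zᗮ` induced by the orthogonal projection onto `Zᗮ`. -/
noncomputable def pairOp (V Z : Submodule ℝ H) : V →L[ℝ] Zᗮ :=
  Zᗮ.orthogonalProjectionOnto ∘L V.subtypeL

theorem orthProj_orthogonal_eq_zero_iff {Z : Submodule ℝ H} (hZ : IsClosed (Z : Set H)) (x : H) :
    Zᗮ.orthogonalProjectionOnto x = 0 ↔ x ∈ Z := by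
  have : CompleteSpace Z := hZ.completeSpace_coe
  rw [Submodule.orthogonalProjectionOnto_eq_zero_iff, Submodule.orthogonal_orthogonal]

theorem map_ker_pairOp (V : Submodule ℝ H) {Z : Submodule ℝ H} (hZ : IsClosed (Z : Set H)) :
    (LinearMap.ker (pairOp V Z).toLinearMap).map V.subtype = V ⊓ Z := by
  rw [← Submodule.map_comap_subtype]
  congr 1
  ext x
  exact orthProj_orthogonal_eq_zero_iff hZ (x : H)

/-- The natural map from `H` to the cokernel of `pairOp V Z`. -/
noncomputable def cokerMap (V Z : Submodule ℝ H) :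
    H →ₗ[ℝ] (Zᗮ ⧸ LinearMap.range (pairOp V Z).toLinearMap) :=
  (LinearMap.range (pairOp V Z).toLinearMap).mkQ ∘ₗ Zᗮ.orthogonalProjectionOnto.toLinearMap

theorem cokerMap_surjective (V Z : Submodule ℝ H) : Function.Surjective (cokerMap V Z) := by
  intro y
  obtain ⟨x, rfl⟩ := Submodule.mkQ_surjective _ y
  refine ⟨x, ?_⟩
  simp [cokerMap]

theorem sup_eq_comap (V : Submodule ℝ H) {Z : Submodule ℝ H} (hZ : IsClosed (Z : Set H)) :
    (LinearMap.range (pairOp V Z).toLinearMap).comap Zᗮ.orthogonalProjectionOnto.toLinearMap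
      = V ⊔ Z := by
  ext x
  rw [Submodule.mem_comap, Submodule.mem_sup]
  constructor
  · rintro ⟨v, hv⟩
    refine ⟨v, v.2, x - v, ?_, by abel⟩
    rw [← orthProj_orthogonal_eq_zero_iff hZ, map_sub, sub_eq_zero]
    exact hv.symm
  · rintro ⟨v, hv, z, hz, rfl⟩
    refine ⟨⟨v, hv⟩, ?_⟩
    have := (orthProj_orthogonal_eq_zero_iff hZ z).2 hz
    change Zᗮ.orthogonalProjectionOnto v = Zᗮ.orthogonalProjectionOnto (v + z)
    rw [map_add, this, add_zero]

theorem ker_cokerMap (V : Submodule ℝ H) {Z : Submodule ℝ H} (hZ : IsClosed (Z : Set H)) :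
    LinearMap.ker (cokerMap V Z) = V ⊔ Z := by
  rw [cokerMap, LinearMap.ker_comp, Submodule.ker_mkQ, sup_eq_comap V hZ]

theorem exists_coker_equiv (V : Submodule ℝ H) {Z : Submodule ℝ H} (hZ : IsClosed (Z : Set H)) :
    Nonempty ((H ⧸ (V ⊔ Z)) ≃ₗ[ℝ] (Zᗮ ⧸ LinearMap.range (pairOp V Z).toLinearMap)) :=
  ⟨(Submodule.quotEquivOfEq _ _ (ker_cokerMap V hZ)).symm.trans
    ((cokerMap V Z).quotKerEquivOfSurjective (cokerMap_surjective V Z))⟩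

theorem fpIndex_eq_index (V : Submodule ℝ H) {Z : Submodule ℝ H} (hZ : IsClosed (Z : Set H)) :
    fpIndex V Z = (pairOp V Z).toLinearMap.index := by
  obtain ⟨e⟩ := exists_coker_equiv V hZ
  rw [fpIndex, LinearMap.index_eq_finrank_sub, e.finrank_eq, ← map_ker_pairOp V hZ,
    Submodule.finrank_map_subtype_eq]

theorem isFredholmPair_iff {V Z : Submodule ℝ H} (hV : IsClosed (V : Set H))
    (hZ : IsClosed (Z : Set H)) :
    IsFredholmPair V Z ↔ AlgFred (pairOp V Z).toLinearMap := by
  have : CompleteSpace V := hV.completeSpace_coe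
  obtain ⟨e⟩ := exists_coker_equiv V hZ
  have e2 := Submodule.equivSubtypeMap _ (LinearMap.ker (pairOp V Z).toLinearMap)
  constructor
  · rintro ⟨h1, _, h3⟩
    rw [← map_ker_pairOp V hZ] at h1
    exact ⟨e2.symm.finiteDimensional, e.finiteDimensional⟩
  · intro h
    have h1 := h.1
    have h2 := h.2
    refine ⟨?_, ?_, e.symm.finiteDimensional⟩
    · rw [← map_ker_pairOp V hZ]
      exact e2.finiteDimensional
    · rw [← sup_eq_comap V hZ]
      exact h.isClosed_range.preimage Zᗮ.orthogonalProjectionOnto.continuous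

/-- The restriction to `V` of the orthogonal projection onto `W`. -/
noncomputable def projOp (V W : Submodule ℝ H) [CompleteSpace W] : V →L[ℝ] W :=
  W.orthogonalProjectionOnto ∘L V.subtypeL

theorem algFred_projOp {V W : Submodule ℝ H} [CompleteSpace V] [CompleteSpace W]
    (hc : IsCompactOperator (W.starProjection - V.starProjection)) :
    AlgFred (projOp V W).toLinearMap := by
  have hc' : IsCompactOperator (V.starProjection - W.starProjection) := by
    have h := hc.neg
    have he : (-⇑(W.starProjection - V.starProjection) : H → H)
        = ⇑(V.starProjection - W.starProjection) := by
      funext x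
      simp
    rwa [he] at h
  have d1 := algFred_id_add_compact
    (V.orthogonalProjectionOnto ∘L (W.starProjection - V.starProjection) ∘L V.subtypeL)
    ((hc.comp_clm V.subtypeL).clm_comp V.orthogonalProjectionOnto)
  have d2 := algFred_id_add_compact
    (W.orthogonalProjectionOnto ∘L (V.starProjection - W.starProjection) ∘L W.subtypeL)
    ((hc'.comp_clm W.subtypeL).clm_comp W.orthogonalProjectionOnto)
  refine algFred_of_comp (g := (projOp W V).toLinearMap) (g' := (projOp W V).toLinearMap) ?_ ?_
  · have he : (projOp W V).toLinearMap ∘ₗ (projOp V W).toLinearMap = LinearMap.id +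
        (V.orthogonalProjectionOnto ∘L (W.starProjection - V.starProjection) ∘L
          V.subtypeL).toLinearMap := by
      ext x
      simp [projOp]
    rw [he]
    exact d1.1
  · have he : (projOp V W).toLinearMap ∘ₗ (projOp W V).toLinearMap = LinearMap.id +
        (W.orthogonalProjectionOnto ∘L (V.starProjection - W.starProjection) ∘L
          W.subtypeL).toLinearMap := by
      ext x
      simp [projOp]
    rw [he]
    exact d2.1

theorem index_projOp {V W : Submodule ℝ H} [CompleteSpace V] [CompleteSpace W]
    (hA : AlgFred (projOp V W).toLinearMap) :
    (projOp V W).toLinearMap.index = - relDim W V := by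
  have hk : (LinearMap.ker (projOp V W).toLinearMap).map V.subtype = Wᗮ ⊓ V := by
    rw [inf_comm, ← Submodule.map_comap_subtype]
    congr 1
    ext x
    exact Submodule.orthogonalProjectionOnto_eq_zero_iff (K := W) (v := (x : H))
  have : CompleteSpace (LinearMap.range (projOp V W).toLinearMap) :=
    hA.isClosed_range.completeSpace_coe
  have hr : ((LinearMap.range (projOp V W).toLinearMap)ᗮ).map W.subtype = W ⊓ Vᗮ := by
    rw [← Submodule.map_comap_subtype]
    congr 1
    ext w
    rw [Submodule.mem_orthogonal, Submodule.mem_comap, Submodule.mem_orthogonal]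
    constructor
    · intro h v hv
      have := h _ ⟨⟨v, hv⟩, rfl⟩
      simpa [projOp] using this
    · rintro h _ ⟨v, rfl⟩
      have := h v v.2
      simpa [projOp] using this
  have e := Submodule.quotientEquivOfIsCompl _ _
    (LinearMap.range (projOp V W).toLinearMap).isCompl_orthogonal
  rw [relDim, LinearMap.index_eq_finrank_sub, ← hk, ← hr, Submodule.finrank_map_subtype_eq,
    Submodule.finrank_map_subtype_eq, e.finrank_eq]
  ring

end Pair

/-- If `(V, Z)` is a Fredholm pair and `W` is a compact perturbation
of `V`, then `(W, Z)` is a Fredholm pair and `ind (W,Z) = ind (V,Z) + dim (W,V)`. -/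
theorem isFredholmPair_of_isCompactPerturbation
    (V Z W : Submodule ℝ H)
    (hV : IsClosed (V : Set H)) (hZ : IsClosed (Z : Set H)) (hW : IsClosed (W : Set H))
    (hpair : IsFredholmPair V Z)
    (hcp : IsCompactPerturbation W V hW hV) :
    IsFredholmPair W Z ∧ fpIndex W Z = fpIndex V Z + relDim W V := by
  have : CompleteSpace V := hV.completeSpace_coe
  have : CompleteSpace W := hW.completeSpace_coe
  have hc : IsCompactOperator (W.starProjection - V.starProjection) := hcp
  have hA := algFred_projOp hc
  have hT := (isFredholmPair_iff hV hZ).1 hpair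
  obtain ⟨h1, h2⟩ := hT.add_compact
    (K := Zᗮ.orthogonalProjectionOnto ∘L (W.starProjection - V.starProjection) ∘L V.subtypeL)
    ((hc.comp_clm V.subtypeL).clm_comp Zᗮ.orthogonalProjectionOnto)
  have heq : (pairOp V Z + Zᗮ.orthogonalProjectionOnto ∘L
      (W.starProjection - V.starProjection) ∘L V.subtypeL).toLinearMap
      = (pairOp W Z).toLinearMap ∘ₗ (projOp V W).toLinearMap := by
    ext x
    simp [pairOp, projOp]
  rw [heq] at h1 h2
  have hB : AlgFred (pairOp W Z).toLinearMap := algFred_of_comp_right hA h1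
  refine ⟨(isFredholmPair_iff hW hZ).2 hB, ?_⟩
  rw [hA.index_comp hB, index_projOp hA] at h2
  rw [fpIndex_eq_index W hZ, fpIndex_eq_index V hZ]
  linarith
end

section
/- Let H be a real Hilbert space and let V, W, Y be closed linear subspaces of H such that W is a compact perturbation of V and Y is a compact perturbation of W (hence Y is also a compact perturbation of V). Then the relative dimensions satisfy the additivity formula dim(Y,V) = dim(Y,W) + dim(W,V). -/
open Module Submodule

variable {H : Type*} [NormedAddCommGroup H] [InnerProductSpace ℝ H] [CompleteSpace H]

section Aux

variable {E : Type*} [NormedAddCommGroup E] [InnerProductSpace ℝ E] [CompleteSpace E]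

lemma aux_surj_of_inj (K : E →L[ℝ] E) (hK : IsCompactOperator K)
    (hi : Function.Injective (1 + K : E →L[ℝ] E)) :
    Function.Surjective (1 + K : E →L[ℝ] E) := by
  rcases hK.hasEigenvalue_or_mem_resolventSet (μ := (-1 : ℝ)) (by norm_num) with h | h
  · exfalso
    obtain ⟨x, hx⟩ := h.exists_hasEigenvector
    apply hx.2
    apply hi
    have := hx.apply_eq_smul
    have h2 : K x = (-1 : ℝ) • x := this
    simp [h2]
  · rw [spectrum.mem_resolventSet_iff] at h
    obtain ⟨u, hu⟩ := h
    intro y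
    have h3 : (u : E →L[ℝ] E) * (↑u⁻¹ : E →L[ℝ] E) = 1 := u.mul_inv
    have h4 := congrArg (fun f : E →L[ℝ] E => f y) h3
    rw [hu] at h4
    refine ⟨-((↑u⁻¹ : E →L[ℝ] E) y), ?_⟩
    simp [Algebra.algebraMap_eq_smul_one] at h4
    simp
    rw [← sub_eq_add_neg] 
    exact h4

lemma aux_ker_fin (K : E →L[ℝ] E) (hK : IsCompactOperator K) :
    FiniteDimensional ℝ (1 + K : E →L[ℝ] E).ker := by
  have := ContinuousLinearMap.finite_dimensional_eigenspace hK (-1 : ℝ) (by norm_num)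
  have h : (1 + K : E →L[ℝ] E).ker = Module.End.eigenspace K.toLinearMap (-1 : ℝ) := by
    ext x
    rw [Module.End.mem_eigenspace_iff, LinearMap.mem_ker]
    simp
    rw [add_comm, ← eq_neg_iff_add_eq_zero]
  rw [h]; exact this

lemma aux_inj_of_surj (K : E →L[ℝ] E) (hK : IsCompactOperator K)
    (hs : Function.Surjective (1 + K : E →L[ℝ] E)) :
    Function.Injective (1 + K : E →L[ℝ] E) := by
  have := aux_ker_fin K hK
  set S : E →L[ℝ] E := 1 + K with hS
  obtain ⟨G, hG⟩ : ∃ G : E →L[ℝ] E, ∀ y, S (G y) = y := by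
    let N := S.ker
    let T : Nᗮ →L[ℝ] E := S.comp Nᗮ.subtypeL
    have hTi : T.ker = ⊥ := by
      rw [LinearMap.ker_eq_bot']
      intro x hx
      have h1 : (x : E) ∈ N := hx
      have h2 := Submodule.inner_right_of_mem_orthogonal h1 x.2
      exact Subtype.ext (inner_self_eq_zero.mp h2)
    have hTs : T.range = ⊤ := by
      rw [LinearMap.range_eq_top]
      intro y
      obtain ⟨x, rfl⟩ := hs y
      refine ⟨⟨x - N.starProjection x, N.sub_starProjection_mem_orthogonal x⟩, ?_⟩
      have : S (N.starProjection x) = 0 := N.starProjection_apply_mem x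
      show S (x - N.starProjection x) = S x
      rw [map_sub, this, sub_zero]
    let e := ContinuousLinearEquiv.ofBijective T hTi hTs
    refine ⟨Nᗮ.subtypeL.comp e.symm.toContinuousLinearMap, fun y => ?_⟩
    exact ContinuousLinearEquiv.ofBijective_apply_symm_apply T hTi hTs y
  have hGeq : G = 1 + (-(K.comp G)) := by
    ext y
    have := hG y
    simp [hS] at this ⊢
    rw [eq_add_neg_iff_add_eq]; exact this
  have hGi : Function.Injective G := fun a b h => by rw [← hG a, ← hG b, h]
  have hGs : Function.Surjective G := by
    have hc : IsCompactOperator (-(K.comp G)) := (hK.comp_clm G).neg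
    rw [hGeq] at hGi ⊢
    exact aux_surj_of_inj _ hc hGi
  intro a b hab
  obtain ⟨a, rfl⟩ := hGs a
  obtain ⟨b, rfl⟩ := hGs b
  rw [hG, hG] at hab
  rw [hab]

lemma aux_equiv (K : E →L[ℝ] E) (hK : IsCompactOperator K) :
    Nonempty ((1 + K : E →L[ℝ] E).ker ≃ₗ[ℝ] (E ⧸ (1 + K : E →L[ℝ] E).range)) := by
  have hfin := aux_ker_fin K hK
  set S : E →L[ℝ] E := 1 + K with hS
  set N := S.ker with hN
  obtain ⟨C, hC⟩ := Submodule.exists_isCompl S.range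
  have key : ∀ f : N →ₗ[ℝ] C, (Function.Injective f ↔ Function.Surjective f) := by
    intro f
    let F : N →L[ℝ] E := (C.subtype ∘ₗ f).toContinuousLinearMap
    let A : E →L[ℝ] E := F.comp N.orthogonalProjectionOnto
    have hA : IsCompactOperator A :=
      (isCompactOperator_of_locallyCompactSpace_rng F).comp_clm _
    have hKA : IsCompactOperator (K + A) := hK.add hA
    have hval : ∀ x, (1 + (K + A) : E →L[ℝ] E) x = S x + (f (N.orthogonalProjectionOnto x) : E) := by
      intro x
      simp [hS, A, F, add_assoc]
    have hzero : ∀ x (c : C), S x + (c : E) = 0 → S x = 0 ∧ c = 0 := by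
      intro x c h
      have h1 : S x = 0 := by
        have h2 : S x ∈ C := by
          rw [eq_neg_of_add_eq_zero_left h]; exact C.neg_mem c.2
        have h3 : S x ∈ S.range := ⟨x, rfl⟩
        exact Submodule.disjoint_def.mp hC.disjoint _ h3 h2
      refine ⟨h1, ?_⟩
      rw [h1, zero_add] at h
      exact Subtype.ext h
    have hproj : ∀ n : N, N.orthogonalProjectionOnto (n : E) = n := fun n =>
      Submodule.orthogonalProjectionOnto_mem_subspace_eq_self n
    have hSn : ∀ n : N, S (n : E) = 0 := fun n => n.2
    constructor
    · intro hf
      have hi : Function.Injective (1 + (K + A) : E →L[ℝ] E) := by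
        rw [injective_iff_map_eq_zero]
        intro x hx
        rw [hval] at hx
        obtain ⟨h1, h2⟩ := hzero _ _ hx
        have h3 := hf (h2.trans (map_zero f).symm)
        have h4 := hproj ⟨x, h1⟩
        rw [h3] at h4
        exact congrArg Subtype.val h4.symm
      have hs := aux_surj_of_inj _ hKA hi
      intro c
      obtain ⟨x, hx⟩ := hs c
      rw [hval] at hx
      refine ⟨N.orthogonalProjectionOnto x, ?_⟩
      have := (hzero x (f (N.orthogonalProjectionOnto x) - c) (by
        rw [Submodule.coe_sub, ← add_sub_assoc, hx, sub_self])).2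
      exact sub_eq_zero.mp this
    · intro hf
      have hs : Function.Surjective (1 + (K + A) : E →L[ℝ] E) := by
        intro y
        have hy : y ∈ S.range ⊔ C := by rw [hC.sup_eq_top]; trivial
        obtain ⟨_, ⟨x, rfl⟩, c, hc, rfl⟩ := Submodule.mem_sup.mp hy
        obtain ⟨n, hn⟩ := hf ⟨c, hc⟩
        refine ⟨x - (N.orthogonalProjectionOnto x : E) + (n : E), ?_⟩
        rw [hval]
        simp only [map_add, map_sub, hproj, hSn, sub_zero, add_zero, sub_self, zero_add, hn]
        rfl
      have hi := aux_inj_of_surj _ hKA hs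
      rw [injective_iff_map_eq_zero]
      intro n hn
      have : (n : E) = 0 := by
        apply hi
        rw [hval, map_zero, hproj, hn, hSn]; simp
      exact Subtype.ext this
  have hf : ∃ f : N →ₗ[ℝ] C, Function.Bijective f := by
    rcases le_total (Module.rank ℝ N) (Module.rank ℝ C) with h | h
    · obtain ⟨f, hf⟩ := rank_le_iff_exists_linearMap.mp h
      exact ⟨f, hf, (key f).mp hf⟩
    · obtain ⟨g, hg⟩ := rank_le_iff_exists_linearMap.mp h
      obtain ⟨f, hf⟩ := LinearMap.exists_leftInverse_of_injective g (LinearMap.ker_eq_bot.mpr hg)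
      have hs : Function.Surjective f := fun c => ⟨g c, congrArg (fun l => l c) hf⟩
      exact ⟨f, (key f).mpr hs, hs⟩
  obtain ⟨f, hf⟩ := hf
  exact ⟨(LinearEquiv.ofBijective f hf).trans (Submodule.quotientEquivOfIsCompl _ _ hC).symm⟩

end Aux

section Aux2

/-- The restriction to `V` of the orthogonal projection onto `W`, as a map `V → W`. -/
noncomputable def auxT (V W : Submodule ℝ H) [CompleteSpace W] : V →L[ℝ] W :=
  W.orthogonalProjectionOnto.comp V.subtypeL

lemma auxT_coe (V W : Submodule ℝ H) [CompleteSpace W] (x : V) :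
    ((auxT V W x : W) : H) = W.starProjection (x : H) := rfl

lemma auxT_finrank_ker (V W : Submodule ℝ H) [CompleteSpace W] :
    finrank ℝ (auxT V W).ker = finrank ℝ ↥(Wᗮ ⊓ V) := by
  have hiff : ∀ y : V, y ∈ (auxT V W).ker ↔ (y : H) ∈ Wᗮ := by
    intro y
    have h0 : auxT V W y = W.orthogonalProjectionOnto (y : H) := rfl
    have h1 : y ∈ (auxT V W).ker ↔ auxT V W y = 0 := LinearMap.mem_ker
    rw [h1, h0]
    exact Submodule.orthogonalProjectionOnto_eq_zero_iff
  have h : ((auxT V W).ker).map V.subtype = Wᗮ ⊓ V := by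
    ext x
    constructor
    · rintro ⟨y, hy, rfl⟩
      exact ⟨(hiff y).mp hy, y.2⟩
    · rintro ⟨h1, h2⟩
      exact ⟨⟨x, h2⟩, (hiff ⟨x, h2⟩).mpr h1, rfl⟩
  rw [← h, Submodule.finrank_map_subtype_eq]

lemma auxT_adj (V W : Submodule ℝ H) [CompleteSpace V] [CompleteSpace W] (x : V) (y : W) :
    inner ℝ (auxT V W x) y = inner ℝ x (auxT W V y) := by
  simp only [auxT, ContinuousLinearMap.comp_apply, Submodule.subtypeL_apply]
  rw [Submodule.inner_orthogonalProjectionOnto_eq_of_mem_right,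
    Submodule.inner_orthogonalProjectionOnto_eq_of_mem_left]

lemma auxT_comp (V W : Submodule ℝ H) [CompleteSpace V] [CompleteSpace W]
    (h : IsCompactOperator (W.starProjection - V.starProjection : H →L[ℝ] H)) :
    ∃ K : V →L[ℝ] V, IsCompactOperator K ∧ (auxT W V).comp (auxT V W) = 1 + K := by
  refine ⟨(V.orthogonalProjectionOnto.comp (W.starProjection - V.starProjection)).comp V.subtypeL,
    (h.clm_comp V.orthogonalProjectionOnto).comp_clm V.subtypeL, ?_⟩
  ext x
  simp [auxT]

lemma auxT_comp3 (V W Y : Submodule ℝ H) [CompleteSpace V] [CompleteSpace W] [CompleteSpace Y]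
    (h : IsCompactOperator (W.starProjection - V.starProjection : H →L[ℝ] H))
    (h' : IsCompactOperator (Y.starProjection - V.starProjection : H →L[ℝ] H)) :
    ∃ K : V →L[ℝ] V, IsCompactOperator K ∧
      (auxT Y V).comp ((auxT W Y).comp (auxT V W)) = 1 + K := by
  refine ⟨(V.orthogonalProjectionOnto.comp
    (Y.starProjection.comp (W.starProjection - V.starProjection) +
      (Y.starProjection - V.starProjection))).comp V.subtypeL,
    (((h.clm_comp Y.starProjection).add h').clm_comp V.orthogonalProjectionOnto).comp_clm
      V.subtypeL, ?_⟩
  ext x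
  simp [auxT]

/-- The operator `auxT V W` is Fredholm of index `- relDim W V`. -/
lemma auxT_index (V W : Submodule ℝ H) [CompleteSpace V] [CompleteSpace W]
    (h : IsCompactOperator (W.starProjection - V.starProjection : H →L[ℝ] H)) :
    FiniteDimensional ℝ (auxT V W).ker ∧ FiniteDimensional ℝ (W ⧸ (auxT V W).range) ∧
      (auxT V W).toLinearMap.index = - relDim W V := by
  have h' : IsCompactOperator (V.starProjection - W.starProjection : H →L[ℝ] H) := by
    have := h.neg
    rwa [← ContinuousLinearMap.coe_neg', neg_sub] at this
  obtain ⟨K, hK, hKe⟩ := auxT_comp V W h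
  obtain ⟨L, hL, hLe⟩ := auxT_comp W V h'
  have hk : FiniteDimensional ℝ (auxT V W).ker := by
    have := aux_ker_fin K hK
    rw [← hKe] at this
    exact Submodule.finiteDimensional_of_le
      (show (auxT V W).ker ≤ ((auxT W V).comp (auxT V W)).ker from LinearMap.ker_le_ker_comp _ _)
  have hfinL := aux_ker_fin L hL
  obtain ⟨e⟩ := aux_equiv L hL
  rw [← hLe] at e hfinL
  have hker : ((auxT V W).comp (auxT W V)).ker = (auxT W V).ker := by
    ext y
    constructor
    · intro hy
      have hy' : auxT V W (auxT W V y) = 0 := hy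
      have := auxT_adj V W (auxT W V y) y
      rw [hy', inner_zero_left] at this
      exact inner_self_eq_zero.mp this.symm
    · intro hy
      have hy' : auxT W V y = 0 := hy
      show auxT V W (auxT W V y) = 0
      rw [hy', map_zero]
  have hfq : FiniteDimensional ℝ (W ⧸ ((auxT V W).comp (auxT W V)).range) :=
    Module.Finite.equiv e
  have hle : ((auxT V W).comp (auxT W V)).range ≤ (auxT V W).range :=
    LinearMap.range_comp_le_range _ _
  have hsurj : Function.Surjective (Submodule.factor hle) := Submodule.factor_surjective hle
  have hfc : FiniteDimensional ℝ (W ⧸ (auxT V W).range) :=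
    Module.Finite.of_surjective _ hsurj
  refine ⟨hk, hfc, ?_⟩
  have h1 : finrank ℝ (W ⧸ (auxT V W).range) ≤ finrank ℝ (auxT W V).ker := by
    rw [← hker, e.finrank_eq]
    exact LinearMap.finrank_le_finrank_of_surjective hsurj
  have h2 : finrank ℝ (auxT W V).ker ≤ finrank ℝ (W ⧸ (auxT V W).range) := by
    refine LinearMap.finrank_le_finrank_of_injective
      (f := (auxT V W).range.mkQ ∘ₗ (auxT W V).ker.subtype) ?_
    rw [injective_iff_map_eq_zero]
    intro y hy
    have hy1 : (y : W) ∈ (auxT V W).range := (Submodule.Quotient.mk_eq_zero _).mp hy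
    obtain ⟨x, hx⟩ := hy1
    have hx' : auxT V W x = (y : W) := hx
    have hy2 : auxT W V (y : W) = 0 := y.2
    have := auxT_adj V W x y
    rw [hx', hy2, inner_zero_right] at this
    exact Subtype.ext (inner_self_eq_zero.mp this)
  rw [LinearMap.index_eq_finrank_sub, le_antisymm h1 h2, auxT_finrank_ker, auxT_finrank_ker,
    relDim, inf_comm W]
  ring

lemma relDim_neg (V W : Submodule ℝ H) : relDim V W = - relDim W V := by
  rw [relDim, relDim, inf_comm V, inf_comm W]
  ring

end Aux2

/-- If `W` is a compact perturbation of `V` and `Y` is a compact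
perturbation of `W`, then `Y` is a compact perturbation of `V` and the relative
dimensions satisfy `dim(Y,V) = dim(Y,W) + dim(W,V)`. -/
theorem relDim_add
    (V W Y : Submodule ℝ H)
    (hV : IsClosed (V : Set H)) (hW : IsClosed (W : Set H)) (hY : IsClosed (Y : Set H))
    (hWV : IsCompactPerturbation W V hW hV)
    (hYW : IsCompactPerturbation Y W hY hW) :
    IsCompactPerturbation Y V hY hV ∧ relDim Y V = relDim Y W + relDim W V := by
  haveI : CompleteSpace V := hV.completeSpace_coe
  haveI : CompleteSpace W := hW.completeSpace_coe
  haveI : CompleteSpace Y := hY.completeSpace_coe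
  have h1 : IsCompactOperator (W.starProjection - V.starProjection : H →L[ℝ] H) := hWV
  have h2 : IsCompactOperator (Y.starProjection - W.starProjection : H →L[ℝ] H) := hYW
  have h3 : IsCompactOperator (Y.starProjection - V.starProjection : H →L[ℝ] H) := by
    have := h2.add h1
    rwa [← ContinuousLinearMap.coe_add', sub_add_sub_cancel] at this
  have h4 : IsCompactOperator (V.starProjection - Y.starProjection : H →L[ℝ] H) := by
    have := h3.neg
    rwa [← ContinuousLinearMap.coe_neg', neg_sub] at this
  refine ⟨h3, ?_⟩
  obtain ⟨a1, b1, c1⟩ := auxT_index V W h1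
  obtain ⟨a2, b2, c2⟩ := auxT_index W Y h2
  obtain ⟨a3, b3, c3⟩ := auxT_index Y V h4
  obtain ⟨K, hK, hKe⟩ := auxT_comp3 V W Y h1 h3
  obtain ⟨e⟩ := aux_equiv K hK
  have h0 : (1 + K : V →L[ℝ] V).toLinearMap.index = 0 := by
    rw [LinearMap.index_eq_finrank_sub, e.finrank_eq, sub_self]
  have hcomp : (1 + K : V →L[ℝ] V).toLinearMap =
      ((auxT Y V).toLinearMap ∘ₗ (auxT W Y).toLinearMap) ∘ₗ (auxT V W).toLinearMap := by
    rw [← hKe]; rfl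
  have a4 : FiniteDimensional ℝ ((auxT Y V).toLinearMap ∘ₗ (auxT W Y).toLinearMap).ker := by
    rw [LinearMap.ker_comp]; infer_instance
  have b4 : FiniteDimensional ℝ
      (V ⧸ ((auxT Y V).toLinearMap ∘ₗ (auxT W Y).toLinearMap).range) := by
    rw [LinearMap.range_comp]; infer_instance
  rw [hcomp, LinearMap.index_comp, LinearMap.index_comp, c1, c2, c3] at h0
  have := relDim_neg V Y
  linarith
end

section
/- Let H and E be real Banach spaces, U ⊆ H an open set, and f : U → E a map which is Fréchet differentiable at a point x ∈ U. Suppose there exists r > 0 such that the closed ball of radius r centered at x is contained in U and its image under f is pre-compact in E. Then the differential Df(x) is a compact linear operator. In particular, a map defined on an open set that sends bounded subsets of its domain to pre-compact sets has a compact differential at every point where it is Fréchet differentiable. -/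
/-- If a map `f` between real Banach spaces, defined on an open set `U`
and Fréchet differentiable at `x ∈ U`, sends some closed ball around `x` contained in
`U` to a pre-compact set, then its differential at `x` is a compact operator. -/
theorem isCompactOperator_fderiv_of_precompact_image
    {H E : Type*} [NormedAddCommGroup H] [NormedSpace ℝ H] [CompleteSpace H]
    [NormedAddCommGroup E] [NormedSpace ℝ E] [CompleteSpace E]
    (U : Set H) (hU : IsOpen U) (f : H → E) (x : H) (hx : x ∈ U)
    (f' : H →L[ℝ] E) (hf : HasFDerivAt f f' x)
    (r : ℝ) (hr : 0 < r) (hball : Metric.closedBall x r ⊆ U)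
    (hprecomp : IsCompact (closure (f '' Metric.closedBall x r))) :
    IsCompactOperator (⇑f') := by
  have hK : TotallyBounded (f '' Metric.closedBall x r) :=
    hprecomp.totallyBounded.subset subset_closure
  rw [isCompactOperator_iff_exists_mem_nhds_isCompact_closure_image]
  refine ⟨Metric.closedBall 0 1, Metric.closedBall_mem_nhds 0 one_pos, ?_⟩
  refine TotallyBounded.isCompact_of_isClosed ?_ isClosed_closure
  refine TotallyBounded.closure ?_
  rw [Metric.totallyBounded_iff]
  intro ε hε
  have hlit := (hasFDerivAt_iff_isLittleO_nhds_zero.mp hf).def (c := ε / 4) (by positivity)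
  obtain ⟨δ₀, hδ₀, hball₀⟩ := Metric.eventually_nhds_iff.mp hlit
  obtain ⟨δ, hδ, hδr, hδδ⟩ : ∃ δ : ℝ, 0 < δ ∧ δ ≤ r ∧ δ < δ₀ :=
    ⟨min r (δ₀ / 2), by positivity, min_le_left _ _,
      (min_le_right _ _).trans_lt (by linarith)⟩
  obtain ⟨t, ht, hcov⟩ := Metric.totallyBounded_iff.mp hK (δ * ε / 2) (by positivity)
  refine ⟨(fun c => δ⁻¹ • (c - f x)) '' t, ht.image _, ?_⟩
  rintro _ ⟨v, hv, rfl⟩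
  have hv1 : ‖v‖ ≤ 1 := by simpa using hv
  have hn : ‖δ • v‖ ≤ δ := by
    rw [norm_smul, Real.norm_of_nonneg hδ.le]
    nlinarith
  have hmem : f (x + δ • v) ∈ f '' Metric.closedBall x r := by
    refine ⟨_, ?_, rfl⟩
    simpa [Metric.mem_closedBall, dist_eq_norm] using hn.trans hδr
  obtain ⟨c, hc, hcd⟩ := Set.mem_iUnion₂.mp (hcov hmem)
  have h1 : ‖f (x + δ • v) - f x - f' (δ • v)‖ ≤ ε / 4 * ‖δ • v‖ :=
    hball₀ (by rw [dist_zero_right]; exact hn.trans_lt hδδ)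
  have h1' : ‖f (x + δ • v) - f x - f' (δ • v)‖ ≤ ε / 4 * δ :=
    h1.trans (by gcongr)
  have h2 : ‖f (x + δ • v) - c‖ < δ * ε / 2 := by
    simpa [dist_eq_norm] using hcd
  refine Set.mem_iUnion₂.mpr ⟨_, ⟨c, hc, rfl⟩, ?_⟩
  have key : f' v - δ⁻¹ • (c - f x) =
      δ⁻¹ • ((f (x + δ • v) - c) - (f (x + δ • v) - f x - f' (δ • v))) := by
    have h3 : f' v = δ⁻¹ • f' (δ • v) := by
      rw [map_smul, inv_smul_smul₀ hδ.ne']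
    rw [h3, ← smul_sub]
    congr 1
    abel
  rw [Metric.mem_ball, dist_eq_norm, key, norm_smul, norm_inv, Real.norm_of_nonneg hδ.le,
    inv_mul_lt_iff₀ hδ]
  have h4 := norm_sub_le (f (x + δ • v) - c) (f (x + δ • v) - f x - f' (δ • v))
  nlinarith [mul_pos hδ hε]
end

section
/- Let H be a real Hilbert space with an orthogonal splitting H = H^u ⊕ H^s into closed subspaces, with orthogonal projections P^u and P^s. Let r > 0, let H^s(r) and H^u(r) denote the closed balls of radius r centered at 0 in H^s and H^u, and let σ : H^s(r) → H^u(r) be a 1-Lipschitz map. Then for every ξ ∈ H with ‖P^uξ‖ ≤ r and ‖P^sξ‖ ≤ r, one has ‖P^uξ − σ(P^sξ)‖ ≤ √2 · dist(ξ, graph σ), where graph σ = {η + σ(η) : η ∈ H^s(r)} ⊆ H. -/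
open Module Submodule

variable {H : Type*} [NormedAddCommGroup H] [InnerProductSpace ℝ H] [CompleteSpace H]

/-- Let `H = H^u ⊕ H^s` be an orthogonal splitting and let
`σ : H^s(r) → H^u(r)` be a `1`-Lipschitz map between the closed `r`-balls of `H^s` and
`H^u`.  Then for every `ξ` with `‖P^u ξ‖ ≤ r` and `‖P^s ξ‖ ≤ r` one has
`‖P^u ξ - σ(P^s ξ)‖ ≤ √2 · dist(ξ, graph σ)`. -/
theorem dist_graph_estimate
    (Hu Hs : Submodule ℝ H)
    (hu : IsClosed (Hu : Set H)) (hs : IsClosed (Hs : Set H))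
    (hsplit : Hs = Huᗮ)
    (r : ℝ) (hr : 0 < r)
    (σ : H → H)
    (hσmem : ∀ η ∈ (Hs : Set H) ∩ Metric.closedBall 0 r, σ η ∈ (Hu : Set H) ∩ Metric.closedBall 0 r)
    (hσlip : ∀ η ∈ (Hs : Set H) ∩ Metric.closedBall 0 r,
      ∀ η' ∈ (Hs : Set H) ∩ Metric.closedBall 0 r, ‖σ η - σ η'‖ ≤ ‖η - η'‖)
    (ξ : H)
    (hξu : ‖orthProjL Hu hu ξ‖ ≤ r) (hξs : ‖orthProjL Hs hs ξ‖ ≤ r) :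
    ‖orthProjL Hu hu ξ - σ (orthProjL Hs hs ξ)‖ ≤
      Real.sqrt 2 *
        Metric.infDist ξ {x | ∃ η ∈ (Hs : Set H) ∩ Metric.closedBall 0 r, x = η + σ η} := by
  have hmemu : ∀ x, orthProjL Hu hu x ∈ Hu := fun x => by
    simp [orthProjL]
  have hmems : ∀ x, orthProjL Hs hs x ∈ Hs := fun x => by
    simp [orthProjL]
  have hsum : orthProjL Hu hu ξ + orthProjL Hs hs ξ = ξ := by
    subst hsplit
    haveI : CompleteSpace Hu := hu.completeSpace_coe
    simp [orthProjL]
  set u := orthProjL Hu hu ξ with hudef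
  set s := orthProjL Hs hs ξ with hsdef
  have hu' : u ∈ Hu := hmemu ξ
  have hs' : s ∈ Hs := hmems ξ
  have hsB : s ∈ (Hs : Set H) ∩ Metric.closedBall 0 r := ⟨hs', by simpa using hξs⟩
  have h2 : (0 : ℝ) < Real.sqrt 2 := by positivity
  rw [← div_le_iff₀' h2]
  have hne : {x | ∃ η ∈ (Hs : Set H) ∩ Metric.closedBall 0 r, x = η + σ η}.Nonempty :=
    ⟨s + σ s, s, hsB, rfl⟩
  refine (Metric.le_infDist hne).2 ?_
  rintro _ ⟨η, hη, rfl⟩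
  rw [div_le_iff₀' h2, dist_eq_norm]
  have h1 : ‖u - σ s‖ ≤ ‖u - σ η‖ + ‖s - η‖ := by
    have e : u - σ s = (u - σ η) - (σ s - σ η) := by abel
    rw [e]
    exact (norm_sub_le _ _).trans (by linarith [hσlip s hsB η hη])
  have hort : inner ℝ (u - σ η) (s - η) = 0 := by
    have hm : s - η ∈ Huᗮ := hsplit ▸ Hs.sub_mem hs' hη.1
    exact (Submodule.mem_orthogonal Hu _).1 hm _ (Hu.sub_mem hu' (hσmem η hη).1)
  have hp := norm_add_sq_eq_norm_sq_add_norm_sq_of_inner_eq_zero _ _ hort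
  have e : ξ - (η + σ η) = (u - σ η) + (s - η) := by
    rw [← hsum]; abel
  rw [e]
  refine h1.trans (abs_le_of_sq_le_sq' ?_ (by positivity)).2
  rw [mul_pow, Real.sq_sqrt (by norm_num)]
  nlinarith [sq_nonneg (‖u - σ η‖ - ‖s - η‖)]
end

section
/- Let H be a real Hilbert space with an orthogonal splitting H = H^u ⊕ H^s into closed subspaces, with orthogonal projections P^u and P^s. Let F be a C¹ vector field defined on an open neighborhood U of 0 in H with F(0) = 0, and assume there is λ > 0 such that L = DF(0) satisfies L(H^u) ⊆ H^u, L(H^s) ⊆ H^s, ⟨Lξ,ξ⟩ ≥ λ‖ξ‖² for all ξ ∈ H^u, and ⟨Lξ,ξ⟩ ≤ −λ‖ξ‖² for all ξ ∈ H^s. For r > 0 set Q(r) = {ξ ∈ H : ‖P^uξ‖ ≤ r and ‖P^sξ‖ ≤ r}. Then there exists r₀ > 0 such that for every r ∈ (0, r₀]: (i) for every C¹ solution u : [0,T] → U of u′ = F(u) with u([0,T]) ⊆ Q(r): if ‖P^s u(0)‖ ≤ ‖P^u u(0)‖ then ‖P^s u(t)‖ ≤ ‖P^u u(t)‖ for all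 t ∈ [0,T], and if ‖P^u u(T)‖ ≤ ‖P^s u(T)‖ then ‖P^u u(t)‖ ≤ ‖P^s u(t)‖ for all t ∈ [0,T]; (ii) for every C¹ solution u : [0,T] → U of u′ = F(u) with T > 0: if u(0) ∈ Q(r) and ‖P^u u(0)‖ = r, then u(t) ∉ Q(r) for all sufficiently small t > 0, and if u(T) ∈ Q(r) and ‖P^s u(T)‖ = r, then u(t) ∉ Q(r) for all t < T sufficiently close to T. -/
open Module Submodule Set
open scoped RealInnerProductSpace

section Defs

variable {H : Type*} [NormedAddCommGroup H] [InnerProductSpace ℝ H] [CompleteSpace H]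

/-- The set `Q(r) = {ξ : ‖P^u ξ‖ ≤ r and ‖P^s ξ‖ ≤ r}`. -/
noncomputable def squareNbhd (Hu Hs : Submodule ℝ H)
    (hu : IsClosed (Hu : Set H)) (hs : IsClosed (Hs : Set H)) (r : ℝ) : Set H :=
  {ξ | ‖orthProjL Hu hu ξ‖ ≤ r ∧ ‖orthProjL Hs hs ξ‖ ≤ r}

end Defs

section Helpers

variable {H : Type*} [NormedAddCommGroup H] [InnerProductSpace ℝ H] [CompleteSpace H]

theorem orthProjL_mem (V : Submodule ℝ H) (hV : IsClosed (V : Set H)) (x : H) :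
    orthProjL V hV x ∈ V := by
  haveI : CompleteSpace V := hV.completeSpace_coe
  exact (V.orthogonalProjection x).2

theorem sub_orthProjL_mem (V : Submodule ℝ H) (hV : IsClosed (V : Set H)) (x : H) :
    x - orthProjL V hV x ∈ Vᗮ := by
  haveI : CompleteSpace V := hV.completeSpace_coe
  exact V.sub_starProjection_mem_orthogonal x

theorem inner_orthProjL (V : Submodule ℝ H) (hV : IsClosed (V : Set H)) (p x : H)
    (hp : p ∈ V) : ⟪p, orthProjL V hV x⟫ = ⟪p, x⟫ := by
  have h := (Submodule.mem_orthogonal V _).1 (sub_orthProjL_mem V hV x) p hp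
  rw [inner_sub_right] at h
  linarith

theorem orthProjL_add (Hu Hs : Submodule ℝ H)
    (hu : IsClosed (Hu : Set H)) (hs : IsClosed (Hs : Set H)) (hsplit : Hs = Huᗮ) (x : H) :
    orthProjL Hu hu x + orthProjL Hs hs x = x := by
  have h1 := sub_orthProjL_mem Hu hu x
  have h2 := sub_orthProjL_mem Hs hs x
  have hm := orthProjL_mem Hu hu x
  have hn := orthProjL_mem Hs hs x
  have key : x - orthProjL Hu hu x - orthProjL Hs hs x = 0 := by
    rw [← @inner_self_eq_zero ℝ]
    have ha : x - orthProjL Hu hu x - orthProjL Hs hs x ∈ Hs :=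
      Hs.sub_mem (hsplit ▸ h1) hn
    have e1 := (Submodule.mem_orthogonal Hs _).1 h2 _ ha
    have e2 := (Submodule.mem_orthogonal Hu _).1 ((le_of_eq hsplit) ha) _ hm
    rw [real_inner_comm] at e2
    have : x - orthProjL Hu hu x - orthProjL Hs hs x
      = (x - orthProjL Hs hs x) - orthProjL Hu hu x := by abel
    nth_rewrite 2 [this]
    rw [inner_sub_right, e1, e2, sub_zero]
  rw [sub_sub, sub_eq_zero] at key
  exact key.symm

theorem hasDerivWithinAt_normSq_orthProjL (V : Submodule ℝ H) (hV : IsClosed (V : Set H))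
    (u : ℝ → H) (d : H) (S : Set ℝ) (t : ℝ) (h : HasDerivWithinAt u d S t) :
    HasDerivWithinAt (fun t => ‖orthProjL V hV (u t)‖ ^ 2)
      (2 * ⟪orthProjL V hV (u t), d⟫) S t := by
  have h1 := ((orthProjL V hV).hasFDerivAt.comp_hasDerivWithinAt t h).norm_sq
  rw [← inner_orthProjL V hV _ d (orthProjL_mem V hV (u t))]
  exact h1

theorem slope_pos_near (f : ℝ → ℝ) (d : ℝ) (S : Set ℝ) (x : ℝ)
    (h : HasDerivWithinAt f d S x) (hd : 0 < d) :
    ∃ ε > (0 : ℝ), ∀ t ∈ S, t ≠ x → |t - x| < ε → 0 < (f t - f x) / (t - x) := by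
  have h1 := (hasDerivWithinAt_iff_tendsto_slope.1 h).eventually (lt_mem_nhds hd)
  rw [Filter.Eventually, Metric.mem_nhdsWithin_iff] at h1
  obtain ⟨ε, hε, hsub⟩ := h1
  refine ⟨ε, hε, fun t ht hne hlt => ?_⟩
  have := hsub ⟨by simpa [Real.dist_eq] using hlt, ht, hne⟩
  simpa [slope_def_field] using this

end Helpers

/-- Near a hyperbolic rest point `0` of a `C¹` vector field `F`
(with adapted norm), for all small `r > 0` the cone `{‖P^s ξ‖ ≤ ‖P^u ξ‖}` is
positively invariant with respect to `Q(r)` and the cone `{‖P^u ξ‖ ≤ ‖P^s ξ‖}` is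
negatively invariant; moreover solutions starting on `{‖P^u ξ‖ = r}` leave `Q(r)`
immediately in forward time, and solutions ending on `{‖P^s ξ‖ = r}` leave `Q(r)`
immediately in backward time. -/
theorem cone_invariance_near_hyperbolic_rest_point
    {H : Type*} [NormedAddCommGroup H] [InnerProductSpace ℝ H] [CompleteSpace H]
    (Hu Hs : Submodule ℝ H)
    (hu : IsClosed (Hu : Set H)) (hs : IsClosed (Hs : Set H)) (hsplit : Hs = Huᗮ)
    (U : Set H) (hU : IsOpen U) (h0U : (0 : H) ∈ U)
    (F : H → H) (hF : ContDiffOn ℝ 1 F U) (hF0 : F 0 = 0)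
    (L : H →L[ℝ] H) (hL : HasFDerivAt F L 0)
    (lam : ℝ) (hlam : 0 < lam)
    (hLu : ∀ ξ ∈ Hu, L ξ ∈ Hu) (hLs : ∀ ξ ∈ Hs, L ξ ∈ Hs)
    (hcoerc_u : ∀ ξ ∈ Hu, lam * ‖ξ‖ ^ 2 ≤ ⟪L ξ, ξ⟫)
    (hcoerc_s : ∀ ξ ∈ Hs, ⟪L ξ, ξ⟫ ≤ -lam * ‖ξ‖ ^ 2) :
    ∃ r₀ > (0 : ℝ), ∀ r : ℝ, 0 < r → r ≤ r₀ →
      (∀ T : ℝ, 0 ≤ T → ∀ u : ℝ → H,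
        (∀ t ∈ Icc 0 T, u t ∈ U) →
        (∀ t ∈ Icc 0 T, HasDerivWithinAt u (F (u t)) (Icc 0 T) t) →
        (∀ t ∈ Icc 0 T, u t ∈ squareNbhd Hu Hs hu hs r) →
        ((‖orthProjL Hs hs (u 0)‖ ≤ ‖orthProjL Hu hu (u 0)‖ →
            ∀ t ∈ Icc 0 T, ‖orthProjL Hs hs (u t)‖ ≤ ‖orthProjL Hu hu (u t)‖) ∧
         (‖orthProjL Hu hu (u T)‖ ≤ ‖orthProjL Hs hs (u T)‖ →
            ∀ t ∈ Icc 0 T, ‖orthProjL Hu hu (u t)‖ ≤ ‖orthProjL Hs hs (u t)‖))) ∧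
      (∀ T : ℝ, 0 < T → ∀ u : ℝ → H,
        (∀ t ∈ Icc 0 T, u t ∈ U) →
        (∀ t ∈ Icc 0 T, HasDerivWithinAt u (F (u t)) (Icc 0 T) t) →
        ((u 0 ∈ squareNbhd Hu Hs hu hs r → ‖orthProjL Hu hu (u 0)‖ = r →
            ∃ ε > (0 : ℝ), ∀ t : ℝ, 0 < t → t < ε → t ≤ T →
              u t ∉ squareNbhd Hu Hs hu hs r) ∧
         (u T ∈ squareNbhd Hu Hs hu hs r → ‖orthProjL Hs hs (u T)‖ = r →
            ∃ ε > (0 : ℝ), ∀ t : ℝ, T - ε < t → t < T → 0 ≤ t →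
              u t ∉ squareNbhd Hu Hs hu hs r))) := by
  have hLO := hL.isLittleO.def (show (0 : ℝ) < lam / 4 by positivity)
  rw [Metric.eventually_nhds_iff] at hLO
  obtain ⟨δ, hδ, hR⟩ := hLO
  -- pointwise estimates
  have est : ∀ ξ : H, ‖ξ‖ < δ →
      lam * ‖orthProjL Hu hu ξ‖ ^ 2 - lam / 4 *
        (‖orthProjL Hu hu ξ‖ + ‖orthProjL Hs hs ξ‖) * ‖orthProjL Hu hu ξ‖
        ≤ ⟪orthProjL Hu hu ξ, F ξ⟫ ∧
      ⟪orthProjL Hs hs ξ, F ξ⟫ ≤ -lam * ‖orthProjL Hs hs ξ‖ ^ 2 + lam / 4 *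
        (‖orthProjL Hu hu ξ‖ + ‖orthProjL Hs hs ξ‖) * ‖orthProjL Hs hs ξ‖ := by
    intro ξ hξ
    have hadd := orthProjL_add Hu Hs hu hs hsplit ξ
    have hp := orthProjL_mem Hu hu ξ
    have hq := orthProjL_mem Hs hs ξ
    have hr := hR (y := ξ) (by simpa using hξ)
    simp only [hF0, sub_zero] at hr
    set p := orthProjL Hu hu ξ
    set q := orthProjL Hs hs ξ
    set R := F ξ - L ξ with hRdef
    have hFξ : F ξ = L p + L q + R := by
      rw [hRdef, ← map_add, hadd]; abel
    have hn : ‖R‖ ≤ lam / 4 * (‖p‖ + ‖q‖) := by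
      refine hr.trans ?_
      gcongr
      rw [← hadd]
      exact norm_add_le p q
    have o1 : ⟪p, L q⟫ = 0 :=
      (Submodule.mem_orthogonal Hu _).1 (hsplit ▸ hLs q hq) p hp
    have o2 : ⟪q, L p⟫ = 0 := by
      rw [real_inner_comm]
      exact (Submodule.mem_orthogonal Hu _).1 (hsplit ▸ hq) _ (hLu p hp)
    have c1 := hcoerc_u p hp
    have c2 := hcoerc_s q hq
    rw [real_inner_comm] at c1 c2
    have a1 := abs_le.1 (abs_real_inner_le_norm p R)
    have a2 := abs_le.1 (abs_real_inner_le_norm q R)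
    have b1 := mul_le_mul_of_nonneg_left hn (norm_nonneg p)
    have b2 := mul_le_mul_of_nonneg_left hn (norm_nonneg q)
    rw [hFξ, inner_add_right, inner_add_right, inner_add_right, inner_add_right, o1, o2]
    constructor
    · nlinarith
    · nlinarith
  refine ⟨δ / 4, by positivity, fun r hr hr0 => ?_⟩
  have small : ∀ ξ ∈ squareNbhd Hu Hs hu hs r, ‖ξ‖ < δ := by
    rintro ξ ⟨h1, h2⟩
    have := norm_add_le (orthProjL Hu hu ξ) (orthProjL Hs hs ξ)
    rw [orthProjL_add Hu Hs hu hs hsplit ξ] at this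
    linarith
  refine ⟨?_, ?_⟩
  · intro T hT u _ hder hQ
    have hmono : MonotoneOn
        (fun t => ‖orthProjL Hu hu (u t)‖ ^ 2 - ‖orthProjL Hs hs (u t)‖ ^ 2) (Icc 0 T) := by
      have hd : ∀ t ∈ Icc 0 T, HasDerivWithinAt
          (fun t => ‖orthProjL Hu hu (u t)‖ ^ 2 - ‖orthProjL Hs hs (u t)‖ ^ 2)
          (2 * ⟪orthProjL Hu hu (u t), F (u t)⟫ - 2 * ⟪orthProjL Hs hs (u t), F (u t)⟫)
          (Icc 0 T) t := fun t ht =>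
        (hasDerivWithinAt_normSq_orthProjL Hu hu u _ _ t (hder t ht)).sub
          (hasDerivWithinAt_normSq_orthProjL Hs hs u _ _ t (hder t ht))
      refine monotoneOn_of_hasDerivWithinAt_nonneg (convex_Icc 0 T)
        (fun t ht => (hd t ht).continuousWithinAt)
        (fun t ht => (hd t (interior_subset ht)).mono interior_subset) ?_
      intro t ht
      obtain ⟨e1, e2⟩ := est (u t) (small _ (hQ t (interior_subset ht)))
      set a := ‖orthProjL Hu hu (u t)‖
      set b := ‖orthProjL Hs hs (u t)‖
      nlinarith [mul_nonneg hlam.le (sq_nonneg (a - b)), mul_nonneg hlam.le (sq_nonneg a),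
        mul_nonneg hlam.le (sq_nonneg b)]
    constructor
    · intro h t ht
      have h1 := hmono (left_mem_Icc.2 hT) ht ht.1
      have h2 := pow_le_pow_left₀ (norm_nonneg _) h 2
      simp only at h1
      exact (sq_le_sq₀ (norm_nonneg _) (norm_nonneg _)).1 (by linarith)
    · intro h t ht
      have h1 := hmono ht (right_mem_Icc.2 hT) ht.2
      have h2 := pow_le_pow_left₀ (norm_nonneg _) h 2
      simp only at h1
      exact (sq_le_sq₀ (norm_nonneg _) (norm_nonneg _)).1 (by linarith)
  · intro T hT u _ hder
    constructor
    · intro hQ heq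
      have h0 : (0 : ℝ) ∈ Icc 0 T := left_mem_Icc.2 hT.le
      have e := (est _ (small _ hQ)).1
      have hq := hQ.2
      rw [heq] at e
      obtain ⟨ε, hε, hs'⟩ := slope_pos_near _ _ _ _
        (hasDerivWithinAt_normSq_orthProjL Hu hu u _ _ 0 (hder 0 h0))
        (by
          have := mul_le_mul_of_nonneg_left hq (mul_pos hlam hr).le
          nlinarith [mul_pos hlam (mul_pos hr hr)])
      refine ⟨ε, hε, fun t ht0 htε htT hmem => ?_⟩
      have h1 := hs' t ⟨ht0.le, htT⟩ ht0.ne' (by rwa [sub_zero, abs_of_pos ht0])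
      rw [sub_zero, div_pos_iff_of_pos_right ht0, heq] at h1
      have := pow_le_pow_left₀ (norm_nonneg _) hmem.1 2
      linarith
    · intro hQ heq
      have h0 : T ∈ Icc 0 T := right_mem_Icc.2 hT.le
      have e := (est _ (small _ hQ)).2
      have hq := hQ.1
      rw [heq] at e
      obtain ⟨ε, hε, hs'⟩ := slope_pos_near _ _ _ _
        (hasDerivWithinAt_normSq_orthProjL Hs hs u _ _ T (hder T h0)).neg
        (by
          have := mul_le_mul_of_nonneg_left hq (mul_pos hlam hr).le
          nlinarith [mul_pos hlam (mul_pos hr hr)])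
      refine ⟨ε, hε, fun t htε htT ht0 hmem => ?_⟩
      have h1 := hs' t ⟨ht0, htT.le⟩ htT.ne (by rw [abs_of_neg (by linarith)]; linarith)
      have h2 := mul_neg_of_pos_of_neg h1 (sub_neg.2 htT)
      rw [div_mul_cancel₀ _ (sub_neg.2 htT).ne] at h2
      simp only [Pi.neg_apply, heq] at h2
      have := pow_le_pow_left₀ (norm_nonneg _) hmem.2 2
      linarith
end

section
/- Let X and Y be metric spaces and B ⊆ X. Let 𝓗(B) denote the collection of closed subsets of B and 𝓗(Y) the collection of closed subsets of Y, each endowed with the (extended-valued) Hausdorff distance. Let c ≥ 0 and let Φ : 𝓗(B) → 𝓗(Y) be c-Lipschitz with respect to the Hausdorff distances, and suppose that Φ(Σ₀) is compact for every finite subset Σ₀ ⊆ B. Then for every closed subset Σ ⊆ B, β_Y(Φ(Σ)) ≤ 2c · β_X(Σ). -/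
open scoped ENNReal

/-- The Hausdorff measure of non-compactness of a subset `A` of a (pseudo-e)metric
space: the infimum of all radii `r` such that `A` admits a finite cover by balls of
radius `r` (`+∞` if there is no such `r`). -/
noncomputable def hausdorffMNC {X : Type*} [PseudoEMetricSpace X] (A : Set X) : ℝ≥0∞ :=
  sInf {r : ℝ≥0∞ | ∃ S : Set X, S.Finite ∧ A ⊆ ⋃ x ∈ S, EMetric.ball x r}

theorem hausdorffMNC_le_of_compact {Y : Type*} [PseudoEMetricSpace Y] (A K : Set Y)
    (hK : IsCompact K) (d : ℝ≥0∞) (h : EMetric.hausdorffEdist A K ≤ d) :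
    hausdorffMNC A ≤ d := by
  refine le_of_forall_gt fun r hr => ?_
  obtain ⟨s, hds, hsr⟩ := exists_between hr
  obtain ⟨t, hst, htr⟩ := exists_between hsr
  have hs : t - s ≠ 0 := (tsub_pos_of_lt hst).ne'
  obtain ⟨F, hF, hKF⟩ := EMetric.totallyBounded_iff.1 hK.totallyBounded (t - s) (pos_iff_ne_zero.2 hs)
  refine lt_of_le_of_lt (sInf_le ⟨F, hF, ?_⟩ : hausdorffMNC A ≤ t) htr
  intro a ha
  obtain ⟨k, hk, hak⟩ := EMetric.exists_edist_lt_of_hausdorffEdist_lt ha (lt_of_le_of_lt h hds)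
  have := hKF hk
  simp only [Set.mem_iUnion, EMetric.mem_ball] at this ⊢
  obtain ⟨x, hx, hkx⟩ := this
  refine ⟨x, hx, ?_⟩
  calc edist a x ≤ edist a k + edist k x := edist_triangle _ _ _
    _ < s + (t - s) := ENNReal.add_lt_add hak hkx
    _ = t := add_tsub_cancel_of_le hst.le

/-- Let `Φ` be a `c`-Lipschitz map (for the Hausdorff distances) from
the closed subsets of `B ⊆ X` to the closed subsets of `Y`, sending finite subsets of
`B` to compact sets.  Then `β_Y(Φ(Σ)) ≤ 2c·β_X(Σ)` for every closed `Σ ⊆ B`. -/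
theorem hausdorffMNC_le_of_lipschitz
    {X Y : Type*} [MetricSpace X] [MetricSpace Y]
    (B : Set X) (c : ℝ) (hc : 0 ≤ c)
    (Φ : Set X → Set Y)
    (hΦclosed : ∀ S : Set X, S ⊆ B → IsClosed S → IsClosed (Φ S))
    (hΦlip : ∀ S₁ : Set X, S₁ ⊆ B → IsClosed S₁ → ∀ S₂ : Set X, S₂ ⊆ B → IsClosed S₂ →
      EMetric.hausdorffEdist (Φ S₁) (Φ S₂) ≤ ENNReal.ofReal c * EMetric.hausdorffEdist S₁ S₂)
    (hΦfin : ∀ S : Set X, S ⊆ B → S.Finite → IsCompact (Φ S)) :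
    ∀ Sig : Set X, Sig ⊆ B → IsClosed Sig →
      hausdorffMNC (Φ Sig) ≤ ENNReal.ofReal (2 * c) * hausdorffMNC Sig := by
  intro Sig hSB hS
  by_cases hc0 : c = 0
  · subst hc0
    have h := hΦlip Sig hSB hS ∅ (Set.empty_subset _) isClosed_empty
    simp only [ENNReal.ofReal_zero, zero_mul] at h
    refine (hausdorffMNC_le_of_compact _ _ (hΦfin ∅ (Set.empty_subset _) Set.finite_empty) 0 h).trans
      (by simp)
  have hcpos : 0 < 2 * c := by positivity
  have hne : ENNReal.ofReal (2 * c) ≠ 0 := (ENNReal.ofReal_pos.2 hcpos).ne'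
  rw [mul_comm, ← ENNReal.div_le_iff hne ENNReal.ofReal_ne_top]
  refine le_sInf ?_
  rintro r ⟨F, hF, hcov⟩
  rw [ENNReal.div_le_iff hne ENNReal.ofReal_ne_top]
  have hch : ∀ x : X, ∃ y : X, (Sig ∩ EMetric.ball x r).Nonempty → y ∈ Sig ∩ EMetric.ball x r := by
    intro x
    by_cases h : (Sig ∩ EMetric.ball x r).Nonempty
    · exact ⟨h.some, fun _ => h.some_mem⟩
    · exact ⟨x, fun h' => absurd h' h⟩
  choose f hf using hch
  have hTfin : ((f '' F) ∩ Sig).Finite := (hF.image f).inter_of_left _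
  have hTS : (f '' F) ∩ Sig ⊆ Sig := Set.inter_subset_right
  have hd : EMetric.hausdorffEdist Sig ((f '' F) ∩ Sig) ≤ 2 * r := by
    refine EMetric.hausdorffEdist_le_of_mem_edist ?_ ?_
    · intro a ha
      have := hcov ha
      simp only [Set.mem_iUnion] at this
      obtain ⟨x, hx, hax⟩ := this
      have h := hf x ⟨a, ha, hax⟩
      refine ⟨f x, ⟨⟨x, hx, rfl⟩, h.1⟩, ?_⟩
      rw [two_mul]
      exact (edist_triangle_right a (f x) x).trans
        (add_le_add (EMetric.mem_ball.1 hax).le (EMetric.mem_ball.1 h.2).le)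
    · intro a ha
      exact ⟨a, ha.2, by simp⟩
  refine hausdorffMNC_le_of_compact _ _ (hΦfin _ (hTS.trans hSB) hTfin) _ ?_
  refine (hΦlip Sig hSB hS _ (hTS.trans hSB) hTfin.isClosed).trans ?_
  calc ENNReal.ofReal c * EMetric.hausdorffEdist Sig ((f '' F) ∩ Sig)
      ≤ ENNReal.ofReal c * (2 * r) := by gcongr
    _ = r * ENNReal.ofReal (2 * c) := by
      rw [ENNReal.ofReal_mul (by norm_num)]
      simp only [ENNReal.ofReal_ofNat]
      ring
end
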